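/- arXiv:2004.05494 — 7 statements merged into one kernel-verified Lean document; each statement's English description precedes it below -/
import Mathlib

section
/- Let P be a finite set of points in ℝ^d, let s be a service function, and let A ⊆ C be finite subsets of ℝ^d. Then for every point a ∈ ℝ^d, the marginal value satisfies mrg(a, A) ≥ mrg(a, C) (submodularity of the service function). -/
open Metric Finset

abbrev Pt (d : ℕ) := EuclideanSpace ℝ (Fin d)

noncomputable instance {d : ℕ} : DecidableEq (Pt d) := Classical.decEq _

/-- A service function: monotonically non-increasing and non-negative on `[0, ∞)`. -/
def IsServiceFunction (s : ℝ → ℝ) : Prop :=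
  (∀ x, 0 ≤ x → 0 ≤ s x) ∧ (∀ x y, 0 ≤ x → x ≤ y → s y ≤ s x)

/-- The service (profit) `ρ(C) = Σ_{p ∈ P} s(dist(p, C))`, with `ρ(∅) = 0`. -/
noncomputable def profit {d : ℕ} (P : Finset (Pt d)) (s : ℝ → ℝ)
    (C : Finset (Pt d)) : ℝ :=
  if C.Nonempty then ∑ p ∈ P, s (Metric.infDist p (C : Set (Pt d))) else 0

/-- The marginal value `mrg(a, C) = ρ(C ∪ {a}) − ρ(C ∖ {a})`. -/
noncomputable def mrg {d : ℕ} (P : Finset (Pt d)) (s : ℝ → ℝ) (a : Pt d)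
    (C : Finset (Pt d)) : ℝ :=
  profit P s (insert a C) - profit P s (C.erase a)

theorem Metric.infDist_insert_of_nonempty {X : Type*} [PseudoMetricSpace X] {S : Set X}
    (hS : S.Nonempty) (x a : X) :
    Metric.infDist x (insert a S) = min (dist x a) (Metric.infDist x S) := by
  apply le_antisymm
  · exact le_min (Metric.infDist_le_dist_of_mem (Set.mem_insert a S))
      (Metric.infDist_le_infDist_of_subset (Set.subset_insert a S) hS)
  · rw [Metric.le_infDist (Set.insert_nonempty a S)]
    rintro y (rfl | hy)
    · exact min_le_left _ _
    · exact (min_le_right _ _).trans (Metric.infDist_le_dist_of_mem hy)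

theorem IsServiceFunction.apply_min_sub_le {s : ℝ → ℝ} (hs : IsServiceFunction s) {x α γ : ℝ}
    (hx : 0 ≤ x) (hγ : 0 ≤ γ) (hγα : γ ≤ α) :
    s (min x γ) - s γ ≤ s (min x α) - s α := by
  rcases le_total x γ with h | h
  · rw [min_eq_left h, min_eq_left (h.trans hγα)]
    linarith [hs.2 γ α hγ hγα]
  · rw [min_eq_right h]
    linarith [hs.2 (min x α) α (le_min hx (hγ.trans hγα)) (min_le_right _ _)]

theorem IsServiceFunction.apply_min_sub_le_apply {s : ℝ → ℝ} (hs : IsServiceFunction s) {x γ : ℝ}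
    (hx : 0 ≤ x) (hγ : 0 ≤ γ) :
    s (min x γ) - s γ ≤ s x := by
  rcases le_total x γ with h | h
  · rw [min_eq_left h]
    linarith [hs.1 γ hγ]
  · rw [min_eq_right h]
    linarith [hs.1 x hx]

/-- Adding a point increases the profit of a smaller set of facilities at least as much. -/
theorem profit_insert_sub_le {d : ℕ} (P : Finset (Pt d)) {s : ℝ → ℝ} (hs : IsServiceFunction s)
    {A C : Finset (Pt d)} (hAC : A ⊆ C) (a : Pt d) :
    profit P s (insert a C) - profit P s C ≤ profit P s (insert a A) - profit P s A := by
  rcases C.eq_empty_or_nonempty with rfl | hC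
  · rw [Finset.subset_empty.mp hAC]
  have hC' : (C : Set (Pt d)).Nonempty := hC
  rcases A.eq_empty_or_nonempty with rfl | hA
  · simp only [profit, Finset.insert_nonempty, hC, Finset.not_nonempty_empty, if_true, if_false,
      Finset.coe_insert, Finset.coe_empty, insert_empty_eq, Metric.infDist_singleton, sub_zero,
      Finset.singleton_nonempty, Finset.coe_singleton,
      Metric.infDist_insert_of_nonempty hC', ← Finset.sum_sub_distrib]
    exact Finset.sum_le_sum fun p _ =>
      hs.apply_min_sub_le_apply dist_nonneg Metric.infDist_nonneg
  · have hA' : (A : Set (Pt d)).Nonempty := hA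
    simp only [profit, Finset.insert_nonempty, hC, hA, if_true, Finset.coe_insert,
      Metric.infDist_insert_of_nonempty hC', Metric.infDist_insert_of_nonempty hA',
      ← Finset.sum_sub_distrib]
    exact Finset.sum_le_sum fun p _ =>
      hs.apply_min_sub_le dist_nonneg Metric.infDist_nonneg
        (Metric.infDist_le_infDist_of_subset (Finset.coe_subset.mpr hAC) hA')

theorem mrg_eq_profit_insert_erase {d : ℕ} (P : Finset (Pt d)) (s : ℝ → ℝ) (a : Pt d)
    (C : Finset (Pt d)) :
    mrg P s a C = profit P s (insert a (C.erase a)) - profit P s (C.erase a) := by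
  have h : insert a (C.erase a) = insert a C := by
    ext x
    by_cases hx : x = a <;> simp [hx]
  rw [mrg, h]

/-- Submodularity: for `A ⊆ C` and any point `a`, `mrg(a, A) ≥ mrg(a, C)`. -/
theorem stmt_0 {d : ℕ} (P : Finset (Pt d)) (s : ℝ → ℝ) (hs : IsServiceFunction s)
    (A C : Finset (Pt d)) (hAC : A ⊆ C) (a : Pt d) :
    mrg P s a A ≥ mrg P s a C := by
  rw [mrg_eq_profit_insert_erase, mrg_eq_profit_insert_erase]
  exact profit_insert_sub_le P hs (Finset.erase_subset_erase a hAC) a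
end

section
/- Let P be a finite set of points in ℝ^d, let s be a service function, and let C ⊆ ℝ^d be a finite set of k ≥ 1 centers. Then for any integer t with 1 ≤ t ≤ k, there exists a subset C' ⊆ C of size t such that ρ(C') ≥ (t/k)·ρ(C). -/
open Metric Finset

/-- Among the `t`-subsets of `C`, some subset carries at least the average share of the total
weight. -/
lemma exists_subset_card_eq_mul_sum_le {α : Type*} [DecidableEq α] (w : α → ℝ) {t : ℕ}
    (ht : 1 ≤ t) (n : ℕ) (C : Finset α) (hC : C.card = t + n) :
    ∃ C' ⊆ C, C'.card = t ∧ (t : ℝ) * ∑ c ∈ C, w c ≤ C.card * ∑ c ∈ C', w c := by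
  induction n generalizing C with
  | zero => exact ⟨C, Subset.rfl, hC, by rw [hC]; simp⟩
  | succ n ih =>
    obtain ⟨c, hc, hmin⟩ := C.exists_min_image w (card_pos.mp (by omega))
    have hle : (C.card : ℝ) * w c ≤ ∑ x ∈ C, w x := by
      simpa using C.card_nsmul_le_sum w (w c) hmin
    have hcard : (C.erase c).card = t + n := by rw [card_erase_of_mem hc]; omega
    obtain ⟨C', hsub, hC', h⟩ := ih (C.erase c) hcard
    refine ⟨C', hsub.trans (erase_subset _ _), hC', ?_⟩
    have hsum := add_sum_erase C w hc
    rw [hcard] at h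
    rw [hC] at hle ⊢
    push_cast at h hle ⊢
    have ht0 : (0 : ℝ) < t := by exact_mod_cast ht
    have hpos : (0 : ℝ) < t + n := by positivity
    rw [← hsum] at hle ⊢
    refine le_of_mul_le_mul_left ?_ hpos
    have h₁ := mul_le_mul_of_nonneg_left h (by positivity : (0 : ℝ) ≤ t + n + 1)
    have h₂ := mul_le_mul_of_nonneg_left hle ht0.le
    linarith

/-- A nonempty finite set contains a nearest point to every point. -/
lemma exists_mem_infDist_eq_dist {α : Type*} [PseudoMetricSpace α] {C : Finset α}
    (hC : C.Nonempty) (p : α) : ∃ c ∈ C, infDist p (C : Set α) = dist p c :=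
  C.finite_toSet.isCompact.exists_infDist_eq_dist hC p

/-- For any `1 ≤ t ≤ k = |C|` there is a `t`-subset `C' ⊆ C` with
`ρ(C') ≥ (t/k)·ρ(C)`. -/
theorem stmt_2 {d : ℕ} (P : Finset (Pt d)) (s : ℝ → ℝ) (hs : IsServiceFunction s)
    (C : Finset (Pt d)) (k t : ℕ) (hCk : C.card = k) (hk : 1 ≤ k)
    (ht : 1 ≤ t) (htk : t ≤ k) :
    ∃ C' ⊆ C, C'.card = t ∧ profit P s C' ≥ ((t : ℝ) / k) * profit P s C := by
  subst hCk
  have hC : C.Nonempty := card_pos.mp hk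
  choose f hfC hf using exists_mem_infDist_eq_dist hC
  obtain ⟨C', hsub, hcard, h⟩ := exists_subset_card_eq_mul_sum_le
    (fun c ↦ ∑ p ∈ P with f p = c, s (dist p (f p))) ht (C.card - t) C (by omega)
  refine ⟨C', hsub, hcard, ?_⟩
  have hC' : C'.Nonempty := card_pos.mp (by omega)
  have htotal : ∑ c ∈ C, ∑ p ∈ P with f p = c, s (dist p (f p)) = profit P s C := by
    rw [sum_fiberwise_of_maps_to (fun p _ ↦ hfC p), profit, if_pos hC]
    simp only [hf]
  have hpart : ∑ c ∈ C', ∑ p ∈ P with f p = c, s (dist p (f p)) ≤ profit P s C' := by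
    rw [sum_fiberwise_eq_sum_filter, profit, if_pos hC', sum_filter]
    refine sum_le_sum fun p _ ↦ ?_
    split_ifs with hp
    · exact hs.2 _ _ infDist_nonneg (infDist_le_dist_of_mem (mem_coe.mpr hp))
    · exact hs.1 _ infDist_nonneg
  have hk0 : (0 : ℝ) < C.card := by exact_mod_cast hk
  rw [htotal] at h
  rw [ge_iff_le, div_mul_eq_mul_div, div_le_iff₀ hk0, mul_comm (profit P s C')]
  exact h.trans (mul_le_mul_of_nonneg_left hpart hk0.le)
end

section
/- Let P be a finite set of points in ℝ^d, let s be a service function, let G ⊆ ℝ^d be a finite set, and let C ⊆ ℝ^d be a finite set with |C| = k ≥ 1. Then for any integer t with 1 ≤ t ≤ k, there exists a subset Y ⊆ C of size t such that ρ(G∪Y) − ρ(G) ≥ (t/k)·(ρ(G∪C) − ρ(G)). -/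
open Metric Finset

/-- The contribution of a single point `p` to the profit of `C`. -/
noncomputable def pointProfit {d : ℕ} (s : ℝ → ℝ) (p : Pt d) (C : Finset (Pt d)) : ℝ :=
  if C.Nonempty then s (Metric.infDist p (C : Set (Pt d))) else 0

lemma profit_eq_sum_pointProfit {d : ℕ} (P : Finset (Pt d)) (s : ℝ → ℝ) (C : Finset (Pt d)) :
    profit P s C = ∑ p ∈ P, pointProfit s p C := by
  unfold profit pointProfit
  split_ifs <;> simp

lemma pointProfit_mono {d : ℕ} {s : ℝ → ℝ} (hs : IsServiceFunction s) (p : Pt d) :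
    Monotone (pointProfit s p) := by
  intro A B hAB
  unfold pointProfit
  split_ifs with hA hB hB
  · exact hs.2 _ _ infDist_nonneg (infDist_le_infDist_of_subset (by exact_mod_cast hAB) hA)
  · exact absurd (hA.mono hAB) hB
  · exact hs.1 _ infDist_nonneg
  · exact le_rfl

/-- The profit of `p` only depends on a nearest center. -/
lemma exists_pointProfit_eq {d : ℕ} (s : ℝ → ℝ) (p : Pt d) {A : Finset (Pt d)}
    (hA : A.Nonempty) :
    ∃ c ∈ A, ∀ B ⊆ A, c ∈ B → pointProfit s p B = pointProfit s p A := by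
  obtain ⟨c, hc, hpc⟩ := A.finite_toSet.isCompact.exists_infDist_eq_dist hA p
  refine ⟨c, hc, fun B hBA hcB => ?_⟩
  have hB : B.Nonempty := ⟨c, hcB⟩
  unfold pointProfit
  rw [if_pos hA, if_pos hB]
  congr 1
  apply le_antisymm
  · rw [hpc]
    exact infDist_le_dist_of_mem hcB
  · exact infDist_le_infDist_of_subset (by exact_mod_cast hBA) hB

lemma sum_pointProfit_sub_erase_le {d : ℕ} {s : ℝ → ℝ} (hs : IsServiceFunction s) (p : Pt d)
    (G C : Finset (Pt d)) :
    ∑ a ∈ C, (pointProfit s p (G ∪ C) - pointProfit s p (G ∪ C.erase a)) ≤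
      pointProfit s p (G ∪ C) - pointProfit s p G := by
  rcases (G ∪ C).eq_empty_or_nonempty with h | h
  · obtain ⟨rfl, rfl⟩ := Finset.union_eq_empty.mp h
    simp
  obtain ⟨c, hc, hcB⟩ := exists_pointProfit_eq s p h
  have hzero : ∀ a, c ∈ G ∪ C.erase a →
      pointProfit s p (G ∪ C) - pointProfit s p (G ∪ C.erase a) = 0 := fun a ha =>
    sub_eq_zero.mpr
      (hcB _ (Finset.union_subset_union_right (Finset.erase_subset _ _)) ha).symm
  by_cases hcC : c ∈ C
  · rw [Finset.sum_eq_single_of_mem c hcC fun a _ hac =>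
      hzero a (Finset.mem_union_right _ (Finset.mem_erase.mpr ⟨hac.symm, hcC⟩))]
    exact sub_le_sub_left (pointProfit_mono hs p Finset.subset_union_left) _
  · have hcG : c ∈ G := (Finset.mem_union.mp hc).resolve_right hcC
    rw [Finset.sum_eq_zero fun a _ => hzero a (Finset.mem_union_left _ hcG)]
    exact sub_nonneg.mpr (pointProfit_mono hs p Finset.subset_union_left)

lemma sum_profit_sub_erase_le {d : ℕ} (P : Finset (Pt d)) {s : ℝ → ℝ}
    (hs : IsServiceFunction s) (G C : Finset (Pt d)) :
    ∑ a ∈ C, (profit P s (G ∪ C) - profit P s (G ∪ C.erase a)) ≤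
      profit P s (G ∪ C) - profit P s G := by
  simp only [profit_eq_sum_pointProfit, ← Finset.sum_sub_distrib]
  rw [Finset.sum_comm]
  exact Finset.sum_le_sum fun p _ => sum_pointProfit_sub_erase_le hs p G C

/-- Some center can be removed while losing at most the average share of the gain over `G`. -/
lemma exists_erase_profit_ge {d : ℕ} (P : Finset (Pt d)) {s : ℝ → ℝ}
    (hs : IsServiceFunction s) (G : Finset (Pt d)) {C : Finset (Pt d)} (hC : C.Nonempty) :
    ∃ a ∈ C, ((C.card : ℝ) - 1) * (profit P s (G ∪ C) - profit P s G) ≤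
      C.card * (profit P s (G ∪ C.erase a) - profit P s G) := by
  have hpos : (0 : ℝ) < C.card := by exact_mod_cast hC.card_pos
  obtain ⟨a, ha, hle⟩ := Finset.exists_le_of_sum_le (s := C)
    (f := fun a => profit P s (G ∪ C) - profit P s (G ∪ C.erase a))
    (g := fun _ => (profit P s (G ∪ C) - profit P s G) / C.card) hC (by
      rw [Finset.sum_const, nsmul_eq_mul, mul_div_cancel₀ _ hpos.ne']
      exact sum_profit_sub_erase_le P hs G C)
  refine ⟨a, ha, ?_⟩
  rw [le_div_iff₀ hpos] at hle
  linarith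

lemma exists_subset_card_profit_ge {d : ℕ} (P : Finset (Pt d)) {s : ℝ → ℝ}
    (hs : IsServiceFunction s) (G : Finset (Pt d)) {t k : ℕ} (ht : 1 ≤ t) (htk : t ≤ k) :
    ∀ C : Finset (Pt d), C.card = k → ∃ Y ⊆ C, Y.card = t ∧
      (t : ℝ) * (profit P s (G ∪ C) - profit P s G) ≤
        k * (profit P s (G ∪ Y) - profit P s G) := by
  induction k, htk using Nat.le_induction with
  | base => exact fun C hC => ⟨C, Finset.Subset.refl C, hC, le_rfl⟩
  | succ n htn ih =>
    intro C hC
    obtain ⟨a, ha, hle⟩ := exists_erase_profit_ge P hs G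
      (Finset.card_pos.mp (by omega : 0 < C.card))
    obtain ⟨Y, hY, hYt, hYle⟩ := ih (C.erase a) (by rw [Finset.card_erase_of_mem ha]; omega)
    refine ⟨Y, hY.trans (Finset.erase_subset _ _), hYt, ?_⟩
    have hn : (0 : ℝ) < n := by exact_mod_cast ht.trans htn
    rw [hC] at hle
    push_cast at hle ⊢
    refine le_of_mul_le_mul_left ?_ hn
    have h₁ := mul_le_mul_of_nonneg_left hle (Nat.cast_nonneg (α := ℝ) t)
    have h₂ := mul_le_mul_of_nonneg_left hYle (by positivity : (0 : ℝ) ≤ n + 1)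
    linarith

/-- For any finite `G` and `1 ≤ t ≤ k = |C|` there is a `t`-subset `Y ⊆ C` with
`ρ(G∪Y) − ρ(G) ≥ (t/k)·(ρ(G∪C) − ρ(G))`. -/
theorem stmt_3 {d : ℕ} (P : Finset (Pt d)) (s : ℝ → ℝ) (hs : IsServiceFunction s)
    (G C : Finset (Pt d)) (k t : ℕ) (hCk : C.card = k) (hk : 1 ≤ k)
    (ht : 1 ≤ t) (htk : t ≤ k) :
    ∃ Y ⊆ C, Y.card = t ∧
      profit P s (G ∪ Y) - profit P s G ≥
        ((t : ℝ) / k) * (profit P s (G ∪ C) - profit P s G) := by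
  obtain ⟨Y, hY, hYt, hle⟩ := exists_subset_card_profit_ge P hs G ht htk C hCk
  refine ⟨Y, hY, hYt, ?_⟩
  have hk' : (0 : ℝ) < k := by exact_mod_cast hk
  rw [ge_iff_le, div_mul_eq_mul_div, div_le_iff₀' hk']
  exact hle
end

section
/- Let Z be a finite set of points in ℝ^d, and let S, B ⊆ Z be disjoint subsets such that Z∖S is nonempty and such that S and Z∖(S∪B) are Voronoi separated in Z. Then for every point p ∈ ℝ^d with dist(p, S) ≤ dist(p, Z∖S), one has dist(p, B) = dist(p, Z∖S); in particular, the nearest neighbor of p in Z∖S can be taken to lie in B. -/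
open Metric Finset

/-- The Voronoi cell of `p` in the diagram of `Z`:
`VorCell(p,Z) = { x : ‖x−p‖ ≤ dist(x, Z∖{p}) }` (distance to the empty set is `∞`). -/
noncomputable def VorCell {d : ℕ} (p : Pt d) (Z : Finset (Pt d)) : Set (Pt d) :=
  {x | edist x p ≤ EMetric.infEdist x ((Z.erase p : Finset (Pt d)) : Set (Pt d))}

/-- `X` and `Y` are Voronoi separated in `Z`: the Voronoi cells (w.r.t. `Z`) of any
`x ∈ X` and `y ∈ Y` are disjoint. -/
def VorSeparated {d : ℕ} (X Y Z : Finset (Pt d)) : Prop :=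
  ∀ x ∈ X, ∀ y ∈ Y, VorCell x Z ∩ VorCell y Z = ∅

/-- A point is in the cell of `q` as soon as no point of `Z` is closer to it than `q`. -/
lemma mem_vorCell_of_forall_dist_le {d : ℕ} {Z : Finset (Pt d)} {q x : Pt d}
    (h : ∀ z ∈ Z, dist x q ≤ dist x z) : x ∈ VorCell q Z := by
  refine le_infEDist.2 fun z hz => ?_
  rw [edist_dist, edist_dist]
  exact ENNReal.ofReal_le_ofReal (h z (Finset.mem_of_mem_erase hz))

/-- If no point of `Z ∖ S` is closer to `p` than `q` and some point of `S` is at least as close to `p`,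
then the cell of `q` meets the cell of some point of `S`. -/
lemma exists_vorCell_inter_nonempty {d : ℕ} {Z S : Finset (Pt d)} {p q s : Pt d}
    (hq : ∀ z ∈ Z \ S, dist p q ≤ dist p z)
    (hs : s ∈ S) (hsq : dist p s ≤ dist p q) :
    ∃ s' ∈ S, (VorCell s' Z ∩ VorCell q Z).Nonempty := by
  obtain ⟨x, hx, hxS⟩ : ∃ x ∈ segment ℝ p q, infDist x (S : Set (Pt d)) = dist x q := by
    refine (convex_segment p q).isPreconnected.intermediate_value₂ (left_mem_segment ℝ p q)
      (right_mem_segment ℝ p q) (continuous_infDist_pt _).continuousOn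
      (by fun_prop) ((infDist_le_dist_of_mem hs).trans hsq) ?_
    rw [dist_self]
    exact infDist_nonneg
  obtain ⟨s', hs', hxs'⟩ :=
    S.finite_toSet.isCompact.exists_infDist_eq_dist ⟨s, Finset.mem_coe.2 hs⟩ x
  have hqx : ∀ z ∈ Z, dist x q ≤ dist x z := by
    intro z hz
    by_cases hzS : z ∈ S
    · exact hxS ▸ infDist_le_dist_of_mem (Finset.mem_coe.2 hzS)
    · have h₁ := dist_add_dist_of_mem_segment hx
      have h₂ := hq z (Finset.mem_sdiff.2 ⟨hz, hzS⟩)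
      have h₃ := dist_triangle p x z
      linarith
  refine ⟨s', hs', x, mem_vorCell_of_forall_dist_le fun z hz => ?_,
    mem_vorCell_of_forall_dist_le hqx⟩
  rw [← hxs', hxS]
  exact hqx z hz

/-- If `S, B ⊆ Z` are disjoint, `Z∖S` is nonempty, and `S` is Voronoi separated from
`Z∖(S∪B)` in `Z`, then any point `p` with `dist(p,S) ≤ dist(p,Z∖S)` satisfies
`dist(p,B) = dist(p,Z∖S)` (distances to the empty set being `∞`): the nearest
neighbor of `p` in `Z∖S` can be taken to lie in `B`. -/
theorem stmt_10 {d : ℕ} (Z S B : Finset (Pt d)) (hSZ : S ⊆ Z) (hBZ : B ⊆ Z)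
    (hdisj : Disjoint S B) (hne : (Z \ S).Nonempty)
    (hsep : VorSeparated S (Z \ (S ∪ B)) Z) :
    ∀ p : Pt d,
      EMetric.infEdist p (S : Set (Pt d)) ≤
          EMetric.infEdist p ((Z \ S : Finset (Pt d)) : Set (Pt d)) →
        EMetric.infEdist p (B : Set (Pt d)) =
          EMetric.infEdist p ((Z \ S : Finset (Pt d)) : Set (Pt d)) := by
  intro p hp
  change infEDist p (S : Set (Pt d)) ≤ infEDist p ((Z \ S : Finset (Pt d)) : Set (Pt d)) at hp
  change infEDist p (B : Set (Pt d)) = infEDist p ((Z \ S : Finset (Pt d)) : Set (Pt d))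
  have hBS : B ⊆ Z \ S := fun b hb =>
    Finset.mem_sdiff.2 ⟨hBZ hb, Finset.disjoint_right.1 hdisj hb⟩
  refine le_antisymm ?_ (infEDist_anti (Finset.coe_subset.2 hBS))
  obtain ⟨q, hqS, hpq⟩ := (Z \ S).finite_toSet.isCompact.exists_infEDist_eq_edist
    (Finset.coe_nonempty.2 hne) p
  have hSne : S.Nonempty := by
    rw [Finset.nonempty_iff_ne_empty]
    rintro rfl
    rw [hpq, Finset.coe_empty, infEDist_empty, top_le_iff] at hp
    exact edist_ne_top _ _ hp
  obtain ⟨s, hs, hps⟩ := S.finite_toSet.isCompact.exists_infEDist_eq_edist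
    (Finset.coe_nonempty.2 hSne) p
  have dist_le : ∀ {a b : Pt d}, edist p a ≤ edist p b → dist p a ≤ dist p b := by
    intro a b h
    rwa [edist_dist, edist_dist, ENNReal.ofReal_le_ofReal_iff dist_nonneg] at h
  obtain ⟨s', hs', hinter⟩ := exists_vorCell_inter_nonempty
    (fun z hz => dist_le (hpq ▸ infEDist_le_edist_of_mem (Finset.mem_coe.2 hz)))
    hs (dist_le (hps ▸ hpq ▸ hp))
  have hqB : q ∈ B := by
    by_contra hqB
    have hq := Finset.mem_sdiff.1 (Finset.mem_coe.1 hqS)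
    refine hinter.ne_empty (hsep s' hs' q (Finset.mem_sdiff.2 ⟨hq.1, ?_⟩))
    simp [hq.2, hqB]
  exact hpq ▸ infEDist_le_edist_of_mem (Finset.mem_coe.2 hqB)
end

section
/- Let P be a finite set of points in ℝ^d, let s be a service function, let L, B ⊆ ℝ^d be finite disjoint sets with B nonempty, let L = L_1 ⊔ … ⊔ L_m be a partition of L, and let B_1, …, B_m ⊆ B be such that, for each i, the sets L_i and Z∖(L_i∪B_i) are Voronoi separated in Z, where Z = L∪B. Then the marginal value of L over B decomposes over the batches: ρ(Z) − ρ(B) = Σ_{i=1}^m ( ρ(Z) − ρ(Z∖L_i) ). -/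
open Metric Finset

theorem infDist_eq_dist_of_forall_le {α : Type*} [PseudoMetricSpace α] {C : Set α} {x c : α}
    (hc : c ∈ C) (h : ∀ w ∈ C, dist x c ≤ dist x w) : Metric.infDist x C = dist x c :=
  le_antisymm (Metric.infDist_le_dist_of_mem hc) ((Metric.le_infDist ⟨c, hc⟩).2 h)

theorem mem_VorCell_of_forall_le {d : ℕ} {x p : Pt d} {Z : Finset (Pt d)}
    (h : ∀ w ∈ Z, dist x p ≤ dist x w) : x ∈ VorCell p Z := by
  refine Metric.le_infEDist.2 fun w hw => ?_
  rw [edist_dist, edist_dist]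
  exact ENNReal.ofReal_le_ofReal (h w (Finset.mem_of_mem_erase hw))

/-- If a nearest point of `x` in `Z` lies in `X`, then the Voronoi cell of a nearest point of `x`
in `Z ∖ X` meets the Voronoi cell of some point of `X`. -/
theorem exists_VorCell_inter_nonempty {d : ℕ} {X Z : Finset (Pt d)} {x z y : Pt d}
    (hzX : z ∈ X) (hz : ∀ w ∈ Z, dist x z ≤ dist x w)
    (hyZ : y ∈ Z \ X) (hy : ∀ w ∈ Z \ X, dist x y ≤ dist x w) :
    ∃ u ∈ X, (VorCell u Z ∩ VorCell y Z).Nonempty := by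
  obtain ⟨q, hq, hqe⟩ := (convex_segment x y).isPreconnected.intermediate_value₂
    (f := fun q => dist q y) (g := fun q => Metric.infDist q (X : Set (Pt d)))
    (right_mem_segment ℝ x y) (left_mem_segment ℝ x y)
    (by fun_prop) (Metric.continuous_infDist_pt _).continuousOn
    (by simpa using Metric.infDist_nonneg)
    ((Metric.infDist_le_dist_of_mem (Finset.mem_coe.2 hzX)).trans
      (hz y (Finset.mem_sdiff.1 hyZ).1))
  have hqy : ∀ w ∈ Z, dist q y ≤ dist q w := by
    intro w hw
    by_cases hwX : w ∈ X
    · exact hqe.trans_le (Metric.infDist_le_dist_of_mem (Finset.mem_coe.2 hwX))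
    · have hadd := dist_add_dist_of_mem_segment hq
      have hle := hy w (Finset.mem_sdiff.2 ⟨hw, hwX⟩)
      have htri := dist_triangle x q w
      linarith
  obtain ⟨u, huX, hu⟩ := X.exists_min_image (dist q) ⟨z, hzX⟩
  have hqu : dist q y = dist q u := hqe.trans (infDist_eq_dist_of_forall_le huX hu)
  exact ⟨u, huX, q, mem_VorCell_of_forall_le fun w hw => hqu ▸ hqy w hw,
    mem_VorCell_of_forall_le hqy⟩

/-- If `L = L_1 ⊔ … ⊔ L_m` is a partition of `L`, the `B_i ⊆ B` are such that each
`L_i` is Voronoi separated from `Z ∖ (L_i ∪ B_i)` in `Z = L ∪ B`, then the marginal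
value of `L` over `B` decomposes over the batches:
`ρ(Z) − ρ(B) = Σ_i (ρ(Z) − ρ(Z ∖ L_i))`. -/
theorem stmt_11 {d : ℕ} (P : Finset (Pt d)) (s : ℝ → ℝ) (hs : IsServiceFunction s)
    (L B : Finset (Pt d)) (hdisj : Disjoint L B) (hBne : B.Nonempty)
    (m : ℕ) (Lp Bp : Fin m → Finset (Pt d))
    (hLcover : Finset.univ.biUnion Lp = L)
    (hLdisj : ∀ i j, i ≠ j → Disjoint (Lp i) (Lp j))
    (hBp : ∀ i, Bp i ⊆ B)
    (hsep : ∀ i, VorSeparated (Lp i) ((L ∪ B) \ (Lp i ∪ Bp i)) (L ∪ B)) :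
    profit P s (L ∪ B) - profit P s B =
      ∑ i : Fin m, (profit P s (L ∪ B) - profit P s ((L ∪ B) \ Lp i)) := by
  have hLpL : ∀ i, Lp i ⊆ L := fun i =>
    hLcover ▸ Finset.subset_biUnion_of_mem Lp (Finset.mem_univ i)
  have hLpB : ∀ i, ∀ b ∈ B, b ∉ Lp i := fun i b hb hbi =>
    Finset.disjoint_left.1 hdisj (hLpL i hbi) hb
  have hBsub : ∀ i, B ⊆ (L ∪ B) \ Lp i := fun i b hb =>
    Finset.mem_sdiff.2 ⟨Finset.mem_union_right _ hb, hLpB i b hb⟩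
  have hne : ∀ i, ((L ∪ B) \ Lp i).Nonempty := fun i => hBne.mono (hBsub i)
  have hZne : (L ∪ B).Nonempty := hBne.mono Finset.subset_union_right
  simp only [profit, if_pos hBne, if_pos hZne, if_pos (hne _), ← Finset.sum_sub_distrib]
  rw [Finset.sum_comm]
  refine Finset.sum_congr rfl fun p _ => ?_
  obtain ⟨c, hcZ, hc⟩ := (L ∪ B).exists_min_image (dist p) hZne
  have nearest : ∀ C ⊆ L ∪ B, c ∈ C → Metric.infDist p (C : Set (Pt d)) = dist p c :=
    fun C hC hcC => infDist_eq_dist_of_forall_le hcC fun w hw => hc w (hC hw)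
  by_cases hcB : c ∈ B
  · rw [nearest _ subset_rfl hcZ, nearest _ Finset.subset_union_right hcB, sub_self]
    refine (Finset.sum_eq_zero fun i _ => ?_).symm
    rw [nearest _ Finset.sdiff_subset (hBsub i hcB), sub_self]
  · have hcL : c ∈ Finset.univ.biUnion Lp :=
      hLcover ▸ (Finset.mem_union.1 hcZ).resolve_right hcB
    obtain ⟨i, -, hci⟩ := Finset.mem_biUnion.1 hcL
    rw [Finset.sum_eq_single i]
    · obtain ⟨y, hyZ, hy⟩ := ((L ∪ B) \ Lp i).exists_min_image (dist p) (hne i)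
      have hyB : y ∈ B := by
        by_contra hyB
        obtain ⟨u, hu, hmeet⟩ := exists_VorCell_inter_nonempty hci hc hyZ hy
        obtain ⟨hyLB, hyi⟩ := Finset.mem_sdiff.1 hyZ
        refine hmeet.ne_empty (hsep i u hu y (Finset.mem_sdiff.2 ⟨hyLB, fun h => ?_⟩))
        exact (Finset.mem_union.1 h).elim hyi fun h => hyB (hBp i h)
      rw [infDist_eq_dist_of_forall_le hyZ hy,
        infDist_eq_dist_of_forall_le hyB fun w hw => hy w (hBsub i hw)]
    · intro j _ hji
      rw [nearest _ subset_rfl hcZ, nearest _ Finset.sdiff_subset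
        (Finset.mem_sdiff.2 ⟨hcZ, Finset.disjoint_left.1 (hLdisj i j hji.symm) hci⟩), sub_self]
    · exact fun h => absurd (Finset.mem_univ i) h
end

section
/- There exist constants c_1 = c_1(d) > 0 and c_2 = c_2(d) > 0 such that the following holds. Let P be a finite set of points in ℝ^d where every point p carries a positive integer weight w(p) ≤ b, with total weight Σ_{p∈P} w(p) = n ≥ b, where b is a given parameter. Then there exist a closed Euclidean ball β and a finite set S of points lying on the boundary sphere of β such that: (i) |S| ≤ c_1·b^{1−1/d}; (ii) the total weight of the points of P inside β is at least b and at most c_2·b; (iii) P∩β and P∖β are Voronoi separated in P∪S. -/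
open Metric Finset

section Inner

variable {E : Type*} [NormedAddCommGroup E] [InnerProductSpace ℝ E]

lemma dist_lt_dist_iff_inner (x s p : E) :
    dist x s < dist x p ↔ ‖s - p‖ ^ 2 < 2 * inner ℝ (x - p) (s - p) := by
  have h : dist x s ^ 2 = dist x p ^ 2 - 2 * inner ℝ (x - p) (s - p) + ‖s - p‖ ^ 2 := by
    rw [dist_eq_norm, dist_eq_norm, ← norm_sub_sq_real]
    congr 2
    abel
  rw [← sq_lt_sq₀ dist_nonneg dist_nonneg, h]
  constructor <;> intro h' <;> linarith

/-- If the bisectors of `p` with the points of `S` keep the cell of `p` off a sphere, the cell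
does not cross that sphere. -/
lemma exists_dist_lt_of_crosses {p x z : E} {r : ℝ} {S : Finset E}
    (hg : ∀ y, dist y z = r → ∃ s ∈ S, dist y s < dist y p)
    (hx : (dist p z ≤ r ∧ r ≤ dist x z) ∨ (r ≤ dist p z ∧ dist x z ≤ r)) :
    ∃ s ∈ S, dist x s < dist x p := by
  have hpre : IsPreconnected (segment ℝ p x) := (convex_segment p x).isPreconnected
  have hc : ContinuousOn (fun y : E => dist y z) (segment ℝ p x) := by fun_prop
  have hy : r ∈ (fun y : E => dist y z) '' segment ℝ p x := by
    rcases hx with h | h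
    · exact hpre.intermediate_value (left_mem_segment ℝ p x) (right_mem_segment ℝ p x) hc h
    · exact hpre.intermediate_value (right_mem_segment ℝ p x) (left_mem_segment ℝ p x) hc h.symm
  obtain ⟨y, hy, hyr⟩ := hy
  rw [segment_eq_image'] at hy
  obtain ⟨t, ⟨ht0, ht1⟩, rfl⟩ := hy
  obtain ⟨s, hs, hlt⟩ := hg _ hyr
  refine ⟨s, hs, ?_⟩
  rw [dist_lt_dist_iff_inner] at hlt ⊢
  rw [add_sub_cancel_left, real_inner_smul_left] at hlt
  nlinarith [sq_nonneg ‖s - p‖]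

lemma exists_pos_root (a : ℝ) {K : ℝ} (hK : 0 < K) : ∃ t : ℝ, 0 < t ∧ t ^ 2 + 2 * t * a = K := by
  have h0 : 0 ≤ a ^ 2 + K := by positivity
  refine ⟨-a + √(a ^ 2 + K), ?_, ?_⟩
  · have : |a| < √(a ^ 2 + K) := Real.lt_sqrt_of_sq_lt (by rw [sq_abs]; linarith)
    linarith [le_abs_self a]
  · have := Real.sq_sqrt h0
    linear_combination this

/-- Roots of `t ^ 2 + 2 * t * a = K` are antitone in `a`. -/
lemma root_antitone {s t a b K : ℝ} (hK : 0 < K) (ht : 0 < t) (hs : 0 < s) (hab : b ≤ a)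
    (h1 : t ^ 2 + 2 * t * a = K) (h2 : s ^ 2 + 2 * s * b = K) : t ≤ s := by
  by_contra! h
  have h3 : 0 < s + 2 * b := by
    by_contra! h'
    nlinarith [mul_nonneg hs.le (neg_nonneg.2 h')]
  nlinarith [mul_pos (sub_pos.2 h) h3, mul_pos ht (show 0 < (t + 2 * a) - (s + 2 * b) by linarith)]

lemma exists_finset_tilted_directions (E : Type*) [NormedAddCommGroup E] [InnerProductSpace ℝ E]
    [FiniteDimensional ℝ E] :
    ∃ U : Finset E, (∀ u ∈ U, ‖u‖ = 1) ∧ ∀ e v : E, ‖e‖ = 1 → ‖v‖ = 1 →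
      -(3 / 4) ≤ (inner ℝ e v : ℝ) → (inner ℝ e v : ℝ) ≤ 1 / 2 →
      ∃ u ∈ U, 1 / 2 < (inner ℝ u v : ℝ) ∧ (inner ℝ e v : ℝ) < inner ℝ e u := by
  classical
  let K : Set (E × E) := (sphere (0 : E) 1 ×ˢ sphere (0 : E) 1) ∩
    {q | -(3 / 4) ≤ (inner ℝ q.1 q.2 : ℝ) ∧ (inner ℝ q.1 q.2 : ℝ) ≤ 1 / 2}
  have hK : IsCompact K := by
    refine ((isCompact_sphere _ _).prod (isCompact_sphere _ _)).inter_right ?_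
    change IsClosed ({q : E × E | -(3 / 4) ≤ (inner ℝ q.1 q.2 : ℝ)} ∩
      {q | (inner ℝ q.1 q.2 : ℝ) ≤ 1 / 2})
    exact (isClosed_le (by fun_prop) (by fun_prop)).inter (isClosed_le (by fun_prop) (by fun_prop))
  let O : sphere (0 : E) 1 → Set (E × E) := fun u =>
    {q | 1 / 2 < (inner ℝ (u : E) q.2 : ℝ) ∧ (inner ℝ q.1 q.2 : ℝ) < inner ℝ q.1 (u : E)}
  have hO : ∀ u, IsOpen (O u) := fun u => by
    change IsOpen ({q : E × E | 1 / 2 < (inner ℝ (u : E) q.2 : ℝ)} ∩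
      {q | (inner ℝ q.1 q.2 : ℝ) < inner ℝ q.1 (u : E)})
    exact (isOpen_lt (by fun_prop) (by fun_prop)).inter (isOpen_lt (by fun_prop) (by fun_prop))
  have hcov : K ⊆ ⋃ u, O u := by
    rintro ⟨e, v⟩ ⟨⟨he, hv⟩, h1, h2⟩
    simp only [mem_sphere_zero_iff_norm] at he hv h1 h2
    set c : ℝ := inner ℝ e v with hc
    have hee : (inner ℝ e e : ℝ) = 1 := by rw [real_inner_self_eq_norm_sq, he]; norm_num
    have hvv : (inner ℝ v v : ℝ) = 1 := by rw [real_inner_self_eq_norm_sq, hv]; norm_num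
    set w : E := v + (1 / 4 : ℝ) • e with hw
    have hwe : (inner ℝ e w : ℝ) = c + 1 / 4 := by
      rw [hw, inner_add_right, real_inner_smul_right, hee, ← hc]; ring
    have hwv : (inner ℝ w v : ℝ) = 1 + c / 4 := by
      rw [hw, inner_add_left, real_inner_smul_left, hvv, ← hc]; ring
    have hww : ‖w‖ ^ 2 = 17 / 16 + c / 2 := by
      rw [hw, norm_add_sq_real, real_inner_smul_right, norm_smul, he, hv, real_inner_comm, ← hc]
      norm_num; ring
    have hw0 : 0 ≤ ‖w‖ := norm_nonneg w
    have hl : 4 / 5 < ‖w‖ := by nlinarith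
    have hu : ‖w‖ < 23 / 20 := by nlinarith
    have hpos : 0 < ‖w‖ := by linarith
    refine Set.mem_iUnion.2 ⟨⟨‖w‖⁻¹ • w, ?_⟩, ?_, ?_⟩
    · rw [mem_sphere_zero_iff_norm, norm_smul, norm_inv, norm_norm, inv_mul_cancel₀ hpos.ne']
    · simp only [real_inner_smul_left, hwv]
      rw [inv_mul_eq_div, lt_div_iff₀ hpos]
      linarith
    · simp only [real_inner_smul_right, hwe, ← hc]
      rw [inv_mul_eq_div, lt_div_iff₀ hpos]
      rcases le_total 0 c with h | h <;> nlinarith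
  obtain ⟨t, ht⟩ := hK.elim_finite_subcover O hO hcov
  refine ⟨t.image Subtype.val, ?_, fun e v he hv h1 h2 => ?_⟩
  · intro u hu
    obtain ⟨u', -, rfl⟩ := Finset.mem_image.1 hu
    exact mem_sphere_zero_iff_norm.1 u'.2
  · have hmem : (e, v) ∈ K :=
      ⟨⟨mem_sphere_zero_iff_norm.2 he, mem_sphere_zero_iff_norm.2 hv⟩, h1, h2⟩
    obtain ⟨u, hu, h⟩ := Set.mem_iUnion₂.1 (ht hmem)
    exact ⟨u, Finset.mem_image_of_mem _ hu, h⟩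

/-- A bounded number of points of a sphere keeps the Voronoi cell of a given point off the
sphere: here for a point inside the sphere. -/
lemma exists_sphere_guard_inside (E : Type*) [NormedAddCommGroup E] [InnerProductSpace ℝ E]
    [FiniteDimensional ℝ E] :
    ∃ N : ℕ, ∀ (z p : E) (r : ℝ), dist p z < r → ∃ S : Finset E, S.card ≤ N ∧
      (∀ s ∈ S, dist s z = r) ∧ ∀ x, dist x z = r → ∃ s ∈ S, dist x s < dist x p := by
  classical
  obtain ⟨U, hU1, hU⟩ := exists_finset_tilted_directions E
  refine ⟨U.card + 2, fun z p r hpr => ?_⟩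
  have hr : 0 < r := dist_nonneg.trans_lt hpr
  rcases subsingleton_or_nontrivial E with hE | hE
  · refine ⟨∅, by simp, by simp, fun x hx => ?_⟩
    rw [Subsingleton.elim x z, dist_self] at hx
    exact absurd hx hr.ne
  obtain ⟨e, he, hpe⟩ : ∃ e : E, ‖e‖ = 1 ∧ p - z = dist p z • e := by
    rcases eq_or_ne p z with rfl | hne
    · obtain ⟨e, he⟩ := exists_norm_eq E zero_le_one
      exact ⟨e, he, by simp⟩
    · have h0 : ‖p - z‖ ≠ 0 := norm_ne_zero_iff.2 (sub_ne_zero.2 hne)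
      refine ⟨‖p - z‖⁻¹ • (p - z), ?_, ?_⟩
      · rw [norm_smul, norm_inv, norm_norm, inv_mul_cancel₀ h0]
      · rw [dist_eq_norm, smul_smul, mul_inv_cancel₀ h0, one_smul]
  set L := dist p z with hL
  have hL0 : 0 ≤ L := dist_nonneg
  have hK : 0 < r ^ 2 - L ^ 2 := by nlinarith
  have hsphere : ∀ (t : ℝ) (u : E), ‖u‖ = 1 →
      (dist (p + t • u) z) ^ 2 = t ^ 2 + 2 * t * (L * inner ℝ e u) + L ^ 2 := by
    intro t u hu
    rw [dist_eq_norm, add_sub_right_comm, hpe, norm_add_sq_real, real_inner_smul_left,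
      real_inner_smul_right, norm_smul, norm_smul, he, hu, mul_pow, mul_pow, Real.norm_eq_abs,
      Real.norm_eq_abs, sq_abs, sq_abs]
    ring
  choose τ hτ0 hτ using fun u : E => exists_pos_root (L * inner ℝ e u) hK
  set V : Finset E := insert e (insert (-e) U) with hV
  have hV1 : ∀ u ∈ V, ‖u‖ = 1 := by
    intro u hu
    simp only [hV, Finset.mem_insert] at hu
    rcases hu with rfl | rfl | hu
    · exact he
    · rwa [norm_neg]
    · exact hU1 u hu
  refine ⟨V.image fun u => p + τ u • u, ?_, ?_, fun x hx => ?_⟩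
  · refine Finset.card_image_le.trans ?_
    refine (Finset.card_insert_le _ _).trans ?_
    have := Finset.card_insert_le (-e) U
    omega
  · intro s hs
    obtain ⟨u, hu, rfl⟩ := Finset.mem_image.1 hs
    have := hsphere (τ u) u (hV1 u hu)
    rw [hτ] at this
    nlinarith [dist_nonneg (x := p + τ u • u) (y := z)]
  have hxp : x ≠ p := by rintro rfl; exact hpr.ne hx
  have hσ : 0 < ‖x - p‖ := norm_pos_iff.2 (sub_ne_zero.2 hxp)
  set σ := ‖x - p‖ with hσdef
  set v : E := σ⁻¹ • (x - p) with hv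
  have hv1 : ‖v‖ = 1 := by
    rw [hv, norm_smul, norm_inv, Real.norm_of_nonneg hσ.le, ← hσdef, inv_mul_cancel₀ hσ.ne']
  have hxv : x - p = σ • v := by rw [hv, smul_smul, mul_inv_cancel₀ hσ.ne', one_smul]
  have hσK : σ ^ 2 + 2 * σ * (L * inner ℝ e v) = r ^ 2 - L ^ 2 := by
    have := hsphere σ v hv1
    rw [← hxv, add_sub_cancel, hx] at this
    linarith
  suffices h : ∃ u ∈ V, τ u < 2 * σ * inner ℝ u v by
    obtain ⟨u, hu, h⟩ := h
    refine ⟨_, Finset.mem_image_of_mem _ hu, ?_⟩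
    rw [dist_lt_dist_iff_inner, add_sub_cancel_left, hxv, real_inner_smul_left,
      real_inner_smul_right, norm_smul, hV1 u hu, Real.norm_of_nonneg (hτ0 u).le,
      real_inner_comm]
    nlinarith [mul_lt_mul_of_pos_left h (hτ0 u)]
  have hmono : ∀ u ∈ V, 1 / 2 < (inner ℝ u v : ℝ) → (inner ℝ e v : ℝ) ≤ inner ℝ e u →
      ∃ u ∈ V, τ u < 2 * σ * inner ℝ u v := by
    intro u hu h1 h2
    have := root_antitone hK (hτ0 u) hσ (mul_le_mul_of_nonneg_left h2 hL0) (hτ u) hσK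
    exact ⟨u, hu, by nlinarith⟩
  have hee : (inner ℝ e e : ℝ) = 1 := by rw [real_inner_self_eq_norm_sq, he]; norm_num
  rcases lt_or_ge (1 / 2) (inner ℝ e v : ℝ) with h | h
  · refine hmono e (by simp [hV]) h ?_
    rw [hee]
    exact (real_inner_le_norm e v).trans (by rw [he, hv1, one_mul])
  rcases le_or_gt (-(3 / 4)) (inner ℝ e v : ℝ) with h' | h'
  · obtain ⟨u, hu, h1, h2⟩ := hU e v he hv1 h' h
    exact hmono u (by simp [hV, hu]) h1 h2.le
  · refine ⟨-e, by simp [hV], ?_⟩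
    have hτe := hτ (-e)
    have hτe0 := hτ0 (-e)
    rw [inner_neg_right, hee] at hτe
    rw [inner_neg_left]
    set t := τ (-e)
    obtain ⟨c, hc⟩ : ∃ c : ℝ, c = -inner ℝ e v := ⟨_, rfl⟩
    rw [← hc]
    have hσK' : σ ^ 2 - 2 * σ * (L * c) = r ^ 2 - L ^ 2 := by rw [hc]; linarith
    have hc' : 3 / 4 < c := by linarith
    have ht : t = L + r := by
      have : (t - L - r) * (t - L + r) = 0 := by linarith
      rcases mul_eq_zero.1 this with h | h
      · linarith
      · nlinarith
    rw [ht]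
    by_contra! hcon
    have h4 : 0 < σ - 2 * L * c := by
      by_contra! h''
      nlinarith [mul_nonneg hσ.le (neg_nonneg.2 h'')]
    have h5 : (2 * c * σ) * (2 * c * (σ - 2 * L * c)) ≤ (L + r) * ((L + r) - 4 * L * c ^ 2) :=
      mul_le_mul (by linarith) (by nlinarith) (by positivity) (by linarith)
    have h6 : 4 * c ^ 2 * (r - L) ≤ (L + r) - 4 * L * c ^ 2 := by
      have h7 : (L + r) * (4 * c ^ 2 * (r - L)) ≤ (L + r) * ((L + r) - 4 * L * c ^ 2) := by
        refine le_trans (le_of_eq ?_) h5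
        linear_combination (-4 * c ^ 2) * hσK'
      exact le_of_mul_le_mul_left h7 (by linarith)
    nlinarith [mul_pos hr (show 0 < c - 3 / 4 by linarith)]

lemma exists_sphere_guard_outside {z p : E} {r : ℝ} (hr : 0 < r) (hpr : r < dist p z) :
    ∃ s, dist s z = r ∧ ∀ x, dist x z = r → dist x s < dist x p := by
  set L := dist p z with hL
  have hL0 : 0 < L := hr.trans hpr
  have hLn : ‖p - z‖ = L := by rw [hL, dist_eq_norm]
  refine ⟨z + (r / L) • (p - z), ?_, fun x hx => ?_⟩
  · rw [dist_eq_norm, add_sub_cancel_left, norm_smul, hLn, Real.norm_of_nonneg (by positivity),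
      div_mul_cancel₀ _ hL0.ne']
  · have h1 : z + (r / L) • (p - z) - p = (r / L - 1) • (p - z) := by
      rw [sub_smul, one_smul]; abel
    have h2 : x - p = (x - z) - (p - z) := by abel
    have h3 : (inner ℝ (x - z) (p - z) : ℝ) ≤ r * L := by
      refine (real_inner_le_norm _ _).trans (le_of_eq ?_)
      rw [hLn, ← dist_eq_norm, hx]
    rw [dist_lt_dist_iff_inner, h1, h2, inner_sub_left, real_inner_smul_right,
      real_inner_smul_right, real_inner_self_eq_norm_sq, norm_smul, hLn, mul_pow,
      Real.norm_eq_abs, sq_abs]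
    have h4 : 0 < 1 - r / L := by rw [sub_pos, div_lt_one hL0]; exact hpr
    have h5 : r / L * L = r := div_mul_cancel₀ _ hL0.ne'
    have h6 : 0 < L ^ 2 * (1 + r / L) - 2 * inner ℝ (x - z) (p - z) := by
      have : L ^ 2 * (1 + r / L) = L ^ 2 + r * L := by
        linear_combination L * h5
      nlinarith
    nlinarith [mul_pos h4 h6]

lemma exists_sphere_guard (E : Type*) [NormedAddCommGroup E] [InnerProductSpace ℝ E]
    [FiniteDimensional ℝ E] :
    ∃ N : ℕ, ∀ (z p : E) (r : ℝ), 0 < r → dist p z ≠ r → ∃ S : Finset E, S.card ≤ N ∧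
      (∀ s ∈ S, dist s z = r) ∧ ∀ x, dist x z = r → ∃ s ∈ S, dist x s < dist x p := by
  obtain ⟨N, hN⟩ := exists_sphere_guard_inside E
  refine ⟨N + 1, fun z p r hr hpr => ?_⟩
  rcases lt_or_gt_of_ne hpr with h | h
  · obtain ⟨S, hS, h⟩ := hN z p r h
    exact ⟨S, by omega, h⟩
  · obtain ⟨s, hs, h⟩ := exists_sphere_guard_outside hr h
    exact ⟨{s}, by simp, by simpa using hs, fun x hx => ⟨s, by simp, h x hx⟩⟩

end Inner

lemma dist_le_of_mem_vorCell {d : ℕ} {p x s : Pt d} {Z : Finset (Pt d)} (hx : x ∈ VorCell p Z)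
    (hs : s ∈ Z) : dist x p ≤ dist x s := by
  by_cases hsp : s = p
  · rw [hsp]
  have h : edist x p ≤ edist x s := le_trans hx
    (Metric.infEDist_le_edist_of_mem (Finset.mem_coe.2 (Finset.mem_erase.2 ⟨hsp, hs⟩)))
  rw [edist_dist, edist_dist] at h
  exact (ENNReal.ofReal_le_ofReal_iff dist_nonneg).1 h

lemma vorSeparated_of_sphere_guard {d : ℕ} {P S Pin : Finset (Pt d)} {z : Pt d} {r : ℝ}
    (hsub : Pin ⊆ P) (hPin : ∀ p ∈ P, (p ∈ Pin ↔ dist p z ≤ r))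
    (hg : ∀ p ∈ P, ∀ x, dist x z = r → ∃ s ∈ S, dist x s < dist x p) :
    VorSeparated Pin (P \ Pin) (P ∪ S) := by
  intro p hp q hq
  rw [Finset.mem_sdiff] at hq
  have hpr : dist p z ≤ r := (hPin p (hsub hp)).1 hp
  have hqr : r ≤ dist q z := by
    by_contra! h
    exact hq.2 ((hPin q hq.1).2 h.le)
  rw [Set.eq_empty_iff_forall_notMem]
  rintro x ⟨hxp, hxq⟩
  rcases le_total r (dist x z) with h | h
  · obtain ⟨s, hs, hlt⟩ := exists_dist_lt_of_crosses (hg p (hsub hp)) (Or.inl ⟨hpr, h⟩)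
    exact hlt.not_ge (dist_le_of_mem_vorCell hxp (Finset.mem_union_right _ hs))
  · obtain ⟨s, hs, hlt⟩ := exists_dist_lt_of_crosses (hg q hq.1) (Or.inr ⟨hqr, h⟩)
    exact hlt.not_ge (dist_le_of_mem_vorCell hxq (Finset.mem_union_right _ hs))

lemma exists_net_of_code {X T : Type*} [PseudoMetricSpace X] [Fintype T] (A : Set X) (f : X → T)
    (ε : ℝ) (hf : ∀ x ∈ A, ∀ y ∈ A, f x = f y → dist x y ≤ ε) :
    ∃ S : Finset X, S.card ≤ Fintype.card T ∧ (∀ s ∈ S, s ∈ A) ∧ ∀ x ∈ A, ∃ s ∈ S, dist x s ≤ ε := by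
  classical
  rcases A.eq_empty_or_nonempty with rfl | ⟨a, ha⟩
  · exact ⟨∅, by simp, by simp, by simp⟩
  have hg : ∀ t : T, ∃ s ∈ A, ∀ x ∈ A, f x = t → f s = t := by
    intro t
    by_cases h : ∃ x ∈ A, f x = t
    · obtain ⟨x, hx, hxt⟩ := h
      exact ⟨x, hx, fun _ _ _ => hxt⟩
    · exact ⟨a, ha, fun x hx hxt => absurd ⟨x, hx, hxt⟩ h⟩
  choose g hgA hg using hg
  refine ⟨univ.image g, Finset.card_image_le, ?_, fun x hx => ?_⟩
  · intro s hs
    obtain ⟨t, -, rfl⟩ := Finset.mem_image.1 hs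
    exact hgA t
  · exact ⟨g (f x), Finset.mem_image_of_mem _ (mem_univ _),
      hf x hx _ (hgA _) (hg _ x hx rfl).symm⟩

lemma euclidean_dist_le_sum {n : ℕ} (x y : Pt n) : dist x y ≤ ∑ i, |x i - y i| := by
  rw [EuclideanSpace.dist_eq, Real.sqrt_le_left (Finset.sum_nonneg fun _ _ => abs_nonneg _)]
  simp only [Real.dist_eq]
  exact Finset.sum_sq_le_sq_sum_of_nonneg fun _ _ => abs_nonneg _

/-- On the part of a sphere where the `i`-th coordinate is positive and dominates the others, this
coordinate is a Lipschitz function of the others. -/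
lemma abs_sub_le_of_dominant_coord {m : ℕ} {x y : Fin (m + 1) → ℝ} (i : Fin (m + 1)) {δ : ℝ}
    (hnorm : ∑ j, x j ^ 2 = ∑ j, y j ^ 2) (hx : ∀ j, |x j| ≤ x i) (hy : ∀ j, |y j| ≤ y i)
    (h : ∀ j : Fin m, |x (i.succAbove j) - y (i.succAbove j)| ≤ δ) :
    |x i - y i| ≤ m * δ := by
  have hx0 : 0 ≤ x i := (abs_nonneg _).trans (hx i)
  have hy0 : 0 ≤ y i := (abs_nonneg _).trans (hy i)
  rw [Fin.sum_univ_succAbove _ i, Fin.sum_univ_succAbove _ i] at hnorm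
  rcases hx0.eq_or_lt with h0 | h0
  · rcases hy0.eq_or_lt with h1 | h1
    · rw [← h0, ← h1, sub_self, abs_zero]
      rcases Nat.eq_zero_or_pos m with rfl | hm
      · simp
      · exact mul_nonneg (Nat.cast_nonneg _) ((abs_nonneg _).trans (h ⟨0, hm⟩))
    · exfalso
      have : ∑ j : Fin m, x (i.succAbove j) ^ 2 = 0 := Finset.sum_eq_zero fun j _ => by
        have := hx (i.succAbove j)
        rw [← h0, abs_nonpos_iff] at this
        rw [this]; norm_num
      have h2 : 0 ≤ ∑ j : Fin m, y (i.succAbove j) ^ 2 := Finset.sum_nonneg fun _ _ => sq_nonneg _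
      nlinarith
  have hpos : 0 < x i + y i := by linarith
  have key : |x i - y i| * (x i + y i) ≤ (m * δ) * (x i + y i) := by
    calc |x i - y i| * (x i + y i) = |x i ^ 2 - y i ^ 2| := by
          rw [sq_sub_sq, abs_mul, abs_of_pos hpos, mul_comm]
      _ = |∑ j : Fin m, (y (i.succAbove j) ^ 2 - x (i.succAbove j) ^ 2)| := by
          rw [Finset.sum_sub_distrib]; congr 1; linarith
      _ ≤ ∑ j : Fin m, |y (i.succAbove j) ^ 2 - x (i.succAbove j) ^ 2| :=
          Finset.abs_sum_le_sum_abs _ _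
      _ ≤ ∑ _j : Fin m, δ * (x i + y i) := by
          refine Finset.sum_le_sum fun j _ => ?_
          rw [sq_sub_sq, abs_mul, mul_comm, abs_sub_comm]
          refine mul_le_mul (h j) ?_ (abs_nonneg _) ((abs_nonneg _).trans (h j))
          refine (abs_add_le _ _).trans ?_
          linarith [hx (i.succAbove j), hy (i.succAbove j)]
      _ = (m * δ) * (x i + y i) := by simp [mul_assoc]
  exact le_of_mul_le_mul_right key hpos

lemma exists_sphere_net (m k : ℕ) (hk : 0 < k) (z : Pt (m + 1)) (r : ℝ) (hr : 0 < r) :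
    ∃ S : Finset (Pt (m + 1)), S.card ≤ (m + 1) * 2 * (k + 1) ^ m ∧ (∀ s ∈ S, dist s z = r) ∧
      ∀ x, dist x z = r → ∃ s ∈ S, dist x s ≤ 4 * m * r / k := by
  have hk' : (0 : ℝ) < k := Nat.cast_pos.2 hk
  have hdom : ∀ x : Pt (m + 1), ∃ i, ∀ j, |x j - z j| ≤ |x i - z i| := fun x => by
    obtain ⟨i, -, hi⟩ := Finset.exists_max_image univ (fun i => |x i - z i|) univ_nonempty
    exact ⟨i, fun j => hi j (mem_univ j)⟩
  choose ι hι using hdom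
  let cell : ℝ → Fin (k + 1) := fun t => Fin.ofNat (k + 1) ⌊(t + r) * (k / (2 * r))⌋₊
  have hcell : ∀ s t : ℝ, |s| ≤ r → |t| ≤ r → cell s = cell t → |s - t| ≤ 2 * r / k := by
    intro s t hs ht hst
    have hc : 0 < k / (2 * r) := by positivity
    have hb : ∀ u : ℝ, |u| ≤ r → 0 ≤ (u + r) * (k / (2 * r)) ∧
        ⌊(u + r) * (k / (2 * r))⌋₊ < k + 1 := by
      intro u hu
      have hu' := abs_le.1 hu
      have h0 : 0 ≤ (u + r) * (k / (2 * r)) := mul_nonneg (by linarith) hc.le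
      refine ⟨h0, ?_⟩
      rw [Nat.floor_lt h0]
      have : (u + r) * (k / (2 * r)) ≤ (2 * r) * (k / (2 * r)) :=
        mul_le_mul_of_nonneg_right (by linarith) hc.le
      rw [mul_div_cancel₀ _ (by positivity)] at this
      push_cast; linarith
    obtain ⟨hs0, hs1⟩ := hb s hs
    obtain ⟨ht0, ht1⟩ := hb t ht
    have heq : ⌊(s + r) * (k / (2 * r))⌋₊ = ⌊(t + r) * (k / (2 * r))⌋₊ := by
      have := congrArg Fin.val hst
      simpa only [cell, Fin.val_ofNat, Nat.mod_eq_of_lt hs1, Nat.mod_eq_of_lt ht1] using this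
    have h1 := Nat.floor_le hs0
    have h2 := Nat.lt_floor_add_one ((s + r) * (k / (2 * r)))
    have h3 := Nat.floor_le ht0
    have h4 := Nat.lt_floor_add_one ((t + r) * (k / (2 * r)))
    rw [heq] at h1 h2
    have h5 : |s - t| * (k / (2 * r)) ≤ 1 := by
      rw [← abs_of_pos hc, ← abs_mul, abs_le]
      constructor <;> linarith
    rw [← le_div_iff₀ hc] at h5
    rwa [one_div_div] at h5
  let f : Pt (m + 1) → Fin (m + 1) × Bool × (Fin m → Fin (k + 1)) := fun x =>
    (ι x, decide (0 ≤ x (ι x) - z (ι x)),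
      fun j => cell (x ((ι x).succAbove j) - z ((ι x).succAbove j)))
  obtain ⟨S, hS, hSA, hnet⟩ := exists_net_of_code {x | dist x z = r} f (4 * m * r / k) (by
    intro x hx y hy hxy
    simp only [Set.mem_ofPred_eq] at hx hy
    have hsum : ∀ x : Pt (m + 1), dist x z = r → ∑ j, (x j - z j) ^ 2 = r ^ 2 := by
      intro x hx
      rw [← hx, EuclideanSpace.dist_eq, Real.sq_sqrt (Finset.sum_nonneg fun _ _ => sq_nonneg _)]
      simp [Real.dist_eq, sq_abs]
    have hle : ∀ x : Pt (m + 1), dist x z = r → ∀ j, |x j - z j| ≤ r := by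
      intro x hx j
      refine abs_le_of_sq_le_sq ?_ hr.le
      rw [← hsum x hx]
      exact Finset.single_le_sum (f := fun j => (x j - z j) ^ 2) (fun _ _ => sq_nonneg _)
        (mem_univ j)
    simp only [f, Prod.mk.injEq] at hxy
    obtain ⟨h1, h2, h3⟩ := hxy
    have hxd := hι x
    have hyd := hι y
    rw [← h1] at hyd h2 h3
    set i := ι x
    have hj : ∀ j : Fin m,
        |(x (i.succAbove j) - z (i.succAbove j)) - (y (i.succAbove j) - z (i.succAbove j))| ≤
          2 * r / k := fun j =>
      hcell _ _ (hle x hx _) (hle y hy _) (congrFun h3 j)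
    have hi : |(x i - z i) - (y i - z i)| ≤ m * (2 * r / k) := by
      by_cases hs : 0 ≤ x i - z i
      · have hs' : 0 ≤ y i - z i := by simpa [hs] using h2
        rw [abs_of_nonneg hs] at hxd
        rw [abs_of_nonneg hs'] at hyd
        exact abs_sub_le_of_dominant_coord (x := fun j => x j - z j) (y := fun j => y j - z j) i
          ((hsum x hx).trans (hsum y hy).symm) hxd hyd hj
      · have hs' : ¬ 0 ≤ y i - z i := by simpa [hs] using h2
        rw [abs_of_neg (not_le.1 hs)] at hxd
        rw [abs_of_neg (not_le.1 hs')] at hyd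
        have := abs_sub_le_of_dominant_coord (x := fun j => -(x j - z j))
          (y := fun j => -(y j - z j)) (δ := 2 * r / k) i
          (by simpa only [neg_sq] using (hsum x hx).trans (hsum y hy).symm)
          (fun j => by simpa only [abs_neg] using hxd j)
          (fun j => by simpa only [abs_neg] using hyd j)
          (fun j => by rw [← neg_sub', abs_neg]; exact hj j)
        rwa [← neg_sub', abs_neg] at this
    simp only [sub_sub_sub_cancel_right] at hi hj
    calc dist x y ≤ ∑ j, |x j - y j| := euclidean_dist_le_sum x y
      _ = |x i - y i| + ∑ j : Fin m, |x (i.succAbove j) - y (i.succAbove j)| :=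
          Fin.sum_univ_succAbove _ i
      _ ≤ m * (2 * r / k) + ∑ _j : Fin m, 2 * r / k :=
          add_le_add hi (Finset.sum_le_sum fun j _ => hj j)
      _ = 4 * m * r / k := by simp; ring)
  refine ⟨S, hS.trans (le_of_eq ?_), hSA, hnet⟩
  simp [mul_assoc]

lemma sum_biUnion_le_sum_sum {α ι : Type*} [DecidableEq α] (T : Finset ι) (B : ι → Finset α)
    (w : α → ℕ) : ∑ q ∈ T.biUnion B, w q ≤ ∑ t ∈ T, ∑ q ∈ B t, w q := by
  classical
  induction T using Finset.induction_on with
  | empty => simp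
  | insert t T ht ih =>
    rw [Finset.biUnion_insert, Finset.sum_insert ht]
    have := Finset.sum_union_inter (s₁ := B t) (s₂ := T.biUnion B) (f := w)
    omega

/-- If every ball of radius less than `ρ` centered at a point of `P` has weight less than `b`, then
every ball of radius `3 * ρ` has weight `O(b)`. -/
lemma exists_weight_bound (d : ℕ) :
    ∃ M : ℕ, ∀ (P : Finset (Pt d)) (w : Pt d → ℕ) (b : ℕ) (ρ : ℝ) (z : Pt d), 0 < ρ →
      (∀ p ∈ P, ∀ t < ρ, ∑ q ∈ P with dist q p ≤ t, w q ≤ b) →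
      ∑ q ∈ P with dist q z ≤ 3 * ρ, w q ≤ M * b := by
  obtain ⟨T, -, hTfin, hT⟩ := (isCompact_closedBall (0 : Pt d) 3).finite_cover_balls
    (show (0 : ℝ) < 1 / 3 by norm_num)
  lift T to Finset (Pt d) using hTfin
  refine ⟨T.card, fun P w b ρ z hρ hb => ?_⟩
  let B : Pt d → Finset (Pt d) := fun t => P.filter fun q => dist (ρ⁻¹ • (q - z)) t < 1 / 3
  have hsub : (P.filter fun q => dist q z ≤ 3 * ρ) ⊆ T.biUnion B := by
    intro q hq
    rw [Finset.mem_filter] at hq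
    have hmem : ρ⁻¹ • (q - z) ∈ closedBall (0 : Pt d) 3 := by
      rw [mem_closedBall_zero_iff, norm_smul, norm_inv, Real.norm_of_nonneg hρ.le,
        inv_mul_eq_div, div_le_iff₀ hρ, ← dist_eq_norm]
      exact hq.2
    obtain ⟨t, ht, h⟩ := Set.mem_iUnion₂.1 (hT hmem)
    exact Finset.mem_biUnion.2 ⟨t, ht, Finset.mem_filter.2 ⟨hq.1, h⟩⟩
  have hB : ∀ t ∈ T, ∑ q ∈ B t, w q ≤ b := by
    intro t _
    rcases (B t).eq_empty_or_nonempty with h | ⟨p, hp⟩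
    · simp [h]
    refine le_trans (Finset.sum_le_sum_of_subset ?_) (hb p (Finset.mem_filter.1 hp).1
      (2 / 3 * ρ) (by linarith))
    intro q hq
    rw [Finset.mem_filter] at hp hq ⊢
    refine ⟨hq.1, ?_⟩
    have h1 : dist (ρ⁻¹ • (q - z)) (ρ⁻¹ • (p - z)) ≤ 2 / 3 := by
      have := dist_triangle_right (ρ⁻¹ • (q - z)) (ρ⁻¹ • (p - z)) t
      linarith [hp.2, hq.2]
    rw [dist_smul₀, dist_sub_right, norm_inv, Real.norm_of_nonneg hρ.le, inv_mul_eq_div,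
      div_le_iff₀ hρ] at h1
    exact h1
  calc ∑ q ∈ P with dist q z ≤ 3 * ρ, w q ≤ ∑ q ∈ T.biUnion B, w q :=
        Finset.sum_le_sum_of_subset hsub
    _ ≤ ∑ t ∈ T, ∑ q ∈ B t, w q := sum_biUnion_le_sum_sum _ _ _
    _ ≤ ∑ _t ∈ T, b := Finset.sum_le_sum hB
    _ = T.card * b := by simp

lemma exists_minimal_centered_ball {X : Type*} [MetricSpace X] {P : Finset X} {w : X → ℕ} {b : ℕ}
    (hP : P.Nonempty) (hw : ∀ p ∈ P, w p < b) (hb : b ≤ ∑ p ∈ P, w p) :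
    ∃ (z : X) (ρ : ℝ), 0 < ρ ∧ b ≤ ∑ q ∈ P with dist q z ≤ ρ, w q ∧
      ∀ p ∈ P, ∀ t < ρ, ∑ q ∈ P with dist q p ≤ t, w q ≤ b := by
  classical
  let F : Finset (X × X) :=
    (P ×ˢ P).filter fun a => b ≤ ∑ q ∈ P with dist q a.1 ≤ dist a.2 a.1, w q
  have hF : F.Nonempty := by
    obtain ⟨p, hp⟩ := hP
    obtain ⟨q, hq, hmax⟩ := P.exists_max_image (fun q => dist q p) ⟨p, hp⟩
    refine ⟨(p, q), Finset.mem_filter.2 ⟨Finset.mem_product.2 ⟨hp, hq⟩, ?_⟩⟩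
    rwa [Finset.filter_true_of_mem hmax]
  obtain ⟨⟨z, y⟩, hzy, hmin⟩ := F.exists_min_image (fun a => dist a.2 a.1) hF
  obtain ⟨hzyP, hbz⟩ := Finset.mem_filter.1 hzy
  obtain ⟨hz, -⟩ := Finset.mem_product.1 hzyP
  refine ⟨z, dist y z, ?_, hbz, fun p hp t ht => ?_⟩
  · by_contra! h
    have hsub : (P.filter fun q => dist q z ≤ dist y z) ⊆ {z} := by
      intro q hq
      exact Finset.mem_singleton.2 (dist_le_zero.1 ((Finset.mem_filter.1 hq).2.trans h))
    have := hbz.trans (Finset.sum_le_sum_of_subset hsub)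
    rw [Finset.sum_singleton] at this
    exact (hw z hz).not_ge this
  · by_contra! h
    have hne : (P.filter fun q => dist q p ≤ t).Nonempty := by
      rw [Finset.nonempty_iff_ne_empty]
      intro h0
      simp [h0] at h
    obtain ⟨q, hq, hmax⟩ := Finset.exists_max_image _ (fun q => dist q p) hne
    obtain ⟨hqP, hqt⟩ := Finset.mem_filter.1 hq
    have hmem : (p, q) ∈ F := by
      refine Finset.mem_filter.2 ⟨Finset.mem_product.2 ⟨hp, hqP⟩, h.le.trans ?_⟩
      refine Finset.sum_le_sum_of_subset fun x hx => ?_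
      exact Finset.mem_filter.2 ⟨(Finset.mem_filter.1 hx).1, hmax x hx⟩
    exact (hqt.trans_lt ht).not_ge (hmin _ hmem)

/-- Among the `k` concentric shells of width `ρ / (2 * k)` with radii in `(ρ, 2 * ρ)`, one contains
at most a fraction `1 / k` of the points. -/
lemma exists_sparse_shell {X : Type*} [MetricSpace X] (P : Finset X) (z : X) {ρ : ℝ} (hρ : 0 < ρ)
    {k : ℕ} (hk : 0 < k) :
    ∃ r, ρ < r ∧ r < 2 * ρ ∧ (∀ p ∈ P, dist p z ≠ r) ∧
      k * (P.filter fun p => |dist p z - r| ≤ ρ / (4 * k)).card ≤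
        (P.filter fun p => dist p z ≤ 3 * ρ).card := by
  classical
  have hk' : (0 : ℝ) < k := Nat.cast_pos.2 hk
  have hk1 : (1 : ℝ) ≤ k := Nat.one_le_cast.2 hk
  obtain ⟨θ, ⟨hθ0, hθ1⟩, hθ⟩ := (Set.Ioo_infinite (zero_lt_one' ℝ)).exists_notMem_finset
    ((P ×ˢ range k).image fun a => (dist a.1 z / ρ - 1) * k - a.2)
  let R : ℕ → ℝ := fun j => ρ * (1 + (j + θ) / k)
  let A : ℕ → Finset X := fun j => P.filter fun p => |dist p z - R j| ≤ ρ / (4 * k)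
  have hR1 : ∀ j, ρ < R j := fun j => by
    have : 0 < (j + θ) / k := by positivity
    simp only [R]; nlinarith
  have hR2 : ∀ j < k, R j < 2 * ρ := fun j hj => by
    have : (j : ℝ) + 1 ≤ k := by exact_mod_cast hj
    have : (j + θ) / k < 1 := by rw [div_lt_one hk']; linarith
    simp only [R]; nlinarith
  have hε : ρ / (4 * k) ≤ ρ := div_le_self hρ.le (by linarith)
  have hdisj : (range k : Set ℕ).PairwiseDisjoint A := by
    intro i _ j _ hij
    refine Finset.disjoint_left.2 fun p hpi hpj => hij ?_
    have h1 := (Finset.mem_filter.1 hpi).2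
    have h2 := (Finset.mem_filter.1 hpj).2
    have h3 : |R i - R j| ≤ ρ / (2 * k) := by
      have := abs_sub_le (R i) (dist p z) (R j)
      rw [abs_sub_comm (R i) (dist p z)] at this
      refine (this.trans (add_le_add h1 h2)).trans (le_of_eq ?_)
      field_simp; norm_num
    have h4 : R i - R j = (ρ / k) * ((i : ℝ) - j) := by
      simp only [R]; field_simp; ring
    rw [h4, abs_mul, abs_of_pos (by positivity : 0 < ρ / k)] at h3
    have h5 : |(i : ℝ) - j| < 1 := by
      have h6 : ρ / (2 * k) = ρ / k * (1 / 2) := by field_simp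
      rw [h6] at h3
      linarith [le_of_mul_le_mul_left h3 (by positivity)]
    have h7 : |(i : ℤ) - j| < 1 := by exact_mod_cast h5
    have := Int.abs_lt_one_iff.1 h7
    omega
  have hsub : (range k).biUnion A ⊆ P.filter fun p => dist p z ≤ 3 * ρ := by
    intro p hp
    obtain ⟨j, hj, hpj⟩ := Finset.mem_biUnion.1 hp
    obtain ⟨hpP, h⟩ := Finset.mem_filter.1 hpj
    refine Finset.mem_filter.2 ⟨hpP, ?_⟩
    linarith [(abs_le.1 h).2, hR2 j (Finset.mem_range.1 hj)]
  obtain ⟨j, hj, hmin⟩ := (range k).exists_min_image (fun j => (A j).card)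
    (Finset.nonempty_range_iff.2 hk.ne')
  refine ⟨R j, hR1 j, hR2 j (Finset.mem_range.1 hj), fun p hp h => hθ ?_, ?_⟩
  · refine Finset.mem_image.2 ⟨(p, j), Finset.mem_product.2 ⟨hp, hj⟩, ?_⟩
    simp only [h, R]
    field_simp
    ring
  · calc k * (A j).card = (range k).card • (A j).card := by simp
      _ ≤ ∑ i ∈ range k, (A i).card := Finset.card_nsmul_le_sum _ _ _ hmin
      _ = ((range k).biUnion A).card := (Finset.card_biUnion hdisj).symm
      _ ≤ _ := Finset.card_le_card hsub

/-- The conclusion of the separator theorem, with explicit bounds. -/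
def HasSeparator {d : ℕ} (c₁ c₂ : ℝ) (P : Finset (Pt d)) (w : Pt d → ℕ) (b : ℕ) : Prop :=
  ∃ (z : Pt d) (r : ℝ) (Pin S : Finset (Pt d)),
    Pin ⊆ P ∧
    (∀ p ∈ P, (p ∈ Pin ↔ dist p z ≤ r)) ∧
    (∀ q ∈ S, dist q z = r) ∧
    ((S.card : ℝ) ≤ c₁ * (b : ℝ) ^ ((1 : ℝ) - 1 / d)) ∧
    (b ≤ ∑ p ∈ Pin, w p) ∧
    ((∑ p ∈ Pin, w p : ℝ) ≤ c₂ * b) ∧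
    VorSeparated Pin (P \ Pin) (P ∪ S)

lemma HasSeparator.mono {d : ℕ} {c₁ c₂ c₁' c₂' : ℝ} {P : Finset (Pt d)} {w : Pt d → ℕ} {b : ℕ}
    (h : HasSeparator c₁ c₂ P w b) (h₁ : c₁ ≤ c₁') (h₂ : c₂ ≤ c₂') :
    HasSeparator c₁' c₂' P w b := by
  obtain ⟨z, r, Pin, S, h1, h2, h3, h4, h5, h6, h7⟩ := h
  exact ⟨z, r, Pin, S, h1, h2, h3,
    h4.trans (mul_le_mul_of_nonneg_right h₁ (Real.rpow_nonneg (Nat.cast_nonneg _) _)), h5,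
    h6.trans (mul_le_mul_of_nonneg_right h₂ (Nat.cast_nonneg _)), h7⟩

/-- A point of maximal weight `b` can be separated on its own. -/
lemma exists_hasSeparator_of_weight_eq (d : ℕ) :
    ∃ c : ℝ, 0 < c ∧ ∀ (P : Finset (Pt d)) (w : Pt d → ℕ) (b : ℕ), 0 < b →
      (∃ p ∈ P, w p = b) → HasSeparator c 1 P w b := by
  obtain ⟨N, hN⟩ := exists_sphere_guard (Pt d)
  refine ⟨N + 1, by positivity, fun P w b hb ⟨p, hp, hwp⟩ => ?_⟩
  obtain ⟨r, hr, hrP⟩ : ∃ r : ℝ, 0 < r ∧ ∀ q ∈ P.erase p, 2 * r < dist q p := by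
    rcases (P.erase p).eq_empty_or_nonempty with h | h
    · exact ⟨1, one_pos, by simp [h]⟩
    · obtain ⟨q, hq, hmin⟩ := Finset.exists_min_image _ (fun q => dist q p) h
      have hpos : 0 < dist q p := dist_pos.2 (Finset.ne_of_mem_erase hq)
      exact ⟨dist q p / 3, by positivity, fun x hx => by linarith [hmin x hx]⟩
  obtain ⟨S, hS, hSr, hSg⟩ := hN p p r hr (by rw [dist_self]; exact hr.ne)
  have hPin : ∀ q ∈ P, (q ∈ ({p} : Finset (Pt d)) ↔ dist q p ≤ r) := by
    intro q hq
    rw [Finset.mem_singleton]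
    refine ⟨fun h => by rw [h, dist_self]; exact hr.le, fun h => ?_⟩
    by_contra hne
    linarith [hrP q (Finset.mem_erase.2 ⟨hne, hq⟩)]
  have hsub : {p} ⊆ P := Finset.singleton_subset_iff.2 hp
  refine ⟨p, r, {p}, S, hsub, hPin, hSr, ?_, by simp [hwp], by simp [hwp],
    vorSeparated_of_sphere_guard hsub hPin fun q hq x hx => ?_⟩
  · have h1 : (1 : ℝ) ≤ (b : ℝ) ^ ((1 : ℝ) - 1 / d) := by
      refine Real.one_le_rpow (by exact_mod_cast hb) ?_
      rw [sub_nonneg, one_div]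
      exact Nat.cast_inv_le_one d
    have h2 : (S.card : ℝ) ≤ N := by exact_mod_cast hS
    nlinarith [(Nat.cast_nonneg N : (0 : ℝ) ≤ N)]
  · obtain ⟨s, hs, h⟩ := hSg x hx
    refine ⟨s, hs, ?_⟩
    by_cases hqp : q = p
    · rwa [hqp]
    · have := hrP q (Finset.mem_erase.2 ⟨hqp, hq⟩)
      have h3 := dist_triangle_left q p x
      linarith

lemma exists_hasSeparator_of_weight_lt (m : ℕ) :
    ∃ c₁ : ℝ, 0 < c₁ ∧ ∃ c₂ : ℝ, 0 < c₂ ∧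
      ∀ (P : Finset (Pt (m + 1))) (w : Pt (m + 1) → ℕ) (b : ℕ), 0 < b →
        (∀ p ∈ P, 1 ≤ w p ∧ w p < b) → b ≤ ∑ p ∈ P, w p → HasSeparator c₁ c₂ P w b := by
  obtain ⟨N, hN⟩ := exists_sphere_guard (Pt (m + 1))
  obtain ⟨M, hM⟩ := exists_weight_bound (m + 1)
  refine ⟨(m + 1) * 2 * (66 * (m + 1)) ^ m + M * N, by positivity, M + 1, by positivity, ?_⟩
  intro P w b hb hw hbP
  have hP : P.Nonempty := by
    rw [Finset.nonempty_iff_ne_empty]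
    rintro rfl
    simp at hbP; omega
  obtain ⟨z, ρ, hρ, hbz, hmin⟩ := exists_minimal_centered_ball hP (fun p hp => (hw p hp).2) hbP
  have hheavy := hM P w b ρ z hρ hmin
  have hb1 : (1 : ℝ) ≤ b := by exact_mod_cast hb
  have hm1 : ((m + 1 : ℕ) : ℝ) ≠ 0 := by positivity
  set β : ℝ := (b : ℝ) ^ (1 / ((m + 1 : ℕ) : ℝ)) with hβ
  have hβ1 : 1 ≤ β := Real.one_le_rpow hb1 (by positivity)
  have hβpow : β ^ m = (b : ℝ) ^ ((1 : ℝ) - 1 / ((m + 1 : ℕ) : ℝ)) := by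
    rw [hβ, ← Real.rpow_natCast, ← Real.rpow_mul (by positivity)]
    congr 1
    field_simp
    push_cast; ring
  have hβb : β * β ^ m = b := by
    rw [← pow_succ', hβ, ← Real.rpow_natCast, ← Real.rpow_mul (by positivity),
      one_div_mul_cancel hm1, Real.rpow_one]
  set k : ℕ := ⌈β⌉₊ with hk
  have hβk : β ≤ k := Nat.le_ceil β
  have hkβ : (k : ℝ) ≤ 2 * β := by linarith [Nat.ceil_lt_add_one (by linarith : 0 ≤ β)]
  have hk0 : 0 < k := Nat.ceil_pos.2 (by linarith)
  have hk0' : (0 : ℝ) < k := Nat.cast_pos.2 hk0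
  obtain ⟨r, hr1, hr2, hrP, hshell⟩ := exists_sparse_shell P z hρ hk0
  have hr : 0 < r := hρ.trans hr1
  obtain ⟨S₀, hS₀, hS₀r, hS₀net⟩ := exists_sphere_net m (32 * (m + 1) * k) (by positivity) z r hr
  choose! G hGcard hGr hGg using fun p (hp : p ∈ P) => hN z p r hr (hrP p hp)
  set A := P.filter fun p => |dist p z - r| ≤ ρ / (4 * k) with hA
  have hAP : ∀ p ∈ A, p ∈ P := fun p hp => (Finset.mem_filter.1 hp).1
  have hPin : ∀ p ∈ P, (p ∈ P.filter (fun p => dist p z ≤ r) ↔ dist p z ≤ r) := fun p hp => by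
    simp [hp]
  refine ⟨z, r, P.filter fun p => dist p z ≤ r, S₀ ∪ A.biUnion G, Finset.filter_subset _ _, hPin,
    ?_, ?_, ?_, ?_, vorSeparated_of_sphere_guard (Finset.filter_subset _ _) hPin ?_⟩
  · intro q hq
    rcases Finset.mem_union.1 hq with hq | hq
    · exact hS₀r q hq
    · obtain ⟨p, hp, hq⟩ := Finset.mem_biUnion.1 hq
      exact hGr p (hAP p hp) q hq
  · rw [← hβpow]
    have h1 : ((S₀ ∪ A.biUnion G).card : ℝ) ≤ S₀.card + A.card * N := by
      exact_mod_cast (Finset.card_union_le _ _).trans (Nat.add_le_add_left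
        (Finset.card_biUnion_le_card_mul _ _ _ fun p hp => hGcard p (hAP p hp)) _)
    have h2 : (S₀.card : ℝ) ≤ (m + 1) * 2 * ((66 * (m + 1)) ^ m * β ^ m) := by
      have h3 : (S₀.card : ℝ) ≤ (m + 1) * 2 * (32 * (m + 1) * k + 1) ^ m := by
        exact_mod_cast hS₀
      refine h3.trans ?_
      rw [← mul_pow]
      have h4 : (1 : ℝ) ≤ (m + 1) * k := by
        exact_mod_cast Nat.mul_pos m.succ_pos hk0
      have h5 : (32 : ℝ) * (m + 1) * k + 1 ≤ 66 * (m + 1) * β := by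
        have : ((m : ℝ) + 1) * k ≤ (m + 1) * (2 * β) := by gcongr
        linarith
      gcongr
    have h3 : (A.card : ℝ) ≤ M * β ^ m := by
      have h4 : k * A.card ≤ M * b := by
        refine hshell.trans (le_trans ?_ hheavy)
        rw [Finset.card_eq_sum_ones]
        exact Finset.sum_le_sum fun p hp => (hw p (Finset.mem_filter.1 hp).1).1
      have h5 : (k : ℝ) * A.card ≤ M * b := by exact_mod_cast h4
      have h6 : β * A.card ≤ β * (M * β ^ m) := by
        calc β * A.card ≤ k * A.card := by gcongr
          _ ≤ M * b := h5
          _ = β * (M * β ^ m) := by rw [← hβb]; ring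
      exact le_of_mul_le_mul_left h6 (by linarith)
    have h4 : (A.card : ℝ) * N ≤ M * β ^ m * N := by gcongr
    linarith
  · refine hbz.trans (Finset.sum_le_sum_of_subset fun q hq => ?_)
    rw [Finset.mem_filter] at hq ⊢
    exact ⟨hq.1, hq.2.trans hr1.le⟩
  · have h1 : ∑ p ∈ P with dist p z ≤ r, w p ≤ M * b := by
      refine le_trans (Finset.sum_le_sum_of_subset fun q hq => ?_) hheavy
      rw [Finset.mem_filter] at hq ⊢
      exact ⟨hq.1, by linarith [hq.2]⟩
    have h2 : (∑ p ∈ P with dist p z ≤ r, w p : ℝ) ≤ M * b := by exact_mod_cast h1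
    linarith
  · intro p hp x hx
    by_cases hpA : p ∈ A
    · obtain ⟨s, hs, h⟩ := hGg p hp x hx
      exact ⟨s, Finset.mem_union_right _ (Finset.mem_biUnion.2 ⟨p, hpA, hs⟩), h⟩
    · obtain ⟨s, hs, h⟩ := hS₀net x hx
      refine ⟨s, Finset.mem_union_left _ hs, h.trans_lt ?_⟩
      have h1 : ρ / (4 * k) < |dist p z - r| := by
        by_contra! h'
        exact hpA (Finset.mem_filter.2 ⟨hp, h'⟩)
      have h2 : |dist p z - r| ≤ dist x p := by
        rw [← hx, dist_comm x p]
        exact abs_dist_sub_le p x z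
      refine lt_of_le_of_lt ?_ (h1.trans_le h2)
      push_cast
      rw [div_le_div_iff₀ (by positivity) (by positivity)]
      have h3 : (m : ℝ) * r ≤ (m + 1) * (2 * ρ) := by gcongr; linarith
      nlinarith

/-- Voronoi separators for weighted point sets: there are constants `c₁, c₂ > 0`
depending only on `d` such that for any finite weighted point set `P` (weights
positive integers, each at most `b`, total weight `n ≥ b`), there is a closed ball
(of center `z` and radius `r`) and a set `S` of points on its boundary sphere with:
(i) `|S| ≤ c₁·b^{1−1/d}`;
(ii) the total weight of the points of `P` inside the ball (the set `Pin`) is at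
least `b` and at most `c₂·b`;
(iii) `S` Voronoi separates the points of `P` inside the ball from those outside,
in `P ∪ S`. -/
theorem stmt_13 (d : ℕ) :
    ∃ c₁ : ℝ, 0 < c₁ ∧ ∃ c₂ : ℝ, 0 < c₂ ∧
      ∀ (P : Finset (Pt d)) (w : Pt d → ℕ) (b : ℕ),
        (∀ p ∈ P, 1 ≤ w p ∧ w p ≤ b) → b ≤ ∑ p ∈ P, w p →
        ∃ (z : Pt d) (r : ℝ) (Pin S : Finset (Pt d)),
          Pin ⊆ P ∧
          (∀ p ∈ P, (p ∈ Pin ↔ dist p z ≤ r)) ∧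
          (∀ q ∈ S, dist q z = r) ∧
          ((S.card : ℝ) ≤ c₁ * (b : ℝ) ^ ((1 : ℝ) - 1 / d)) ∧
          (b ≤ ∑ p ∈ Pin, w p) ∧
          ((∑ p ∈ Pin, w p : ℝ) ≤ c₂ * b) ∧
          VorSeparated Pin (P \ Pin) (P ∪ S) := by
  obtain ⟨c, hc, hheavy⟩ := exists_hasSeparator_of_weight_eq d
  obtain ⟨c₁, hc₁, c₂, hc₂, hlight⟩ : ∃ c₁ : ℝ, 0 < c₁ ∧ ∃ c₂ : ℝ, 0 < c₂ ∧
      ∀ (P : Finset (Pt d)) (w : Pt d → ℕ) (b : ℕ), 0 < b →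
        (∀ p ∈ P, 1 ≤ w p ∧ w p < b) → b ≤ ∑ p ∈ P, w p → HasSeparator c₁ c₂ P w b := by
    rcases d with _ | m
    · refine ⟨1, one_pos, 1, one_pos, fun P w b hb hw hbP => ?_⟩
      exfalso
      rcases P.eq_empty_or_nonempty with rfl | ⟨p, hp⟩
      · simp at hbP; omega
      · have hPp : P = {p} :=
          Finset.eq_singleton_iff_unique_mem.2 ⟨hp, fun q _ => Subsingleton.elim q p⟩
        rw [hPp, Finset.sum_singleton] at hbP
        exact (hw p hp).2.not_ge hbP
    · exact exists_hasSeparator_of_weight_lt m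
  refine ⟨max c c₁, lt_max_of_lt_left hc, max 1 c₂, lt_max_of_lt_left one_pos,
    fun P w b hw hbP => ?_⟩
  change HasSeparator (max c c₁) (max 1 c₂) P w b
  rcases Nat.eq_zero_or_pos b with rfl | hb
  · have hP : P = ∅ := Finset.eq_empty_of_forall_notMem fun p hp => by
      have := hw p hp
      omega
    subst hP
    refine ⟨0, 0, ∅, ∅, by simp, by simp, by simp, ?_, by simp, by simp, by simp [VorSeparated]⟩
    rw [Finset.card_empty, Nat.cast_zero]
    exact mul_nonneg (hc.le.trans (le_max_left _ _)) (Real.rpow_nonneg le_rfl _)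
  by_cases h : ∃ p ∈ P, w p = b
  · exact (hheavy P w b hb h).mono (le_max_left _ _) (le_max_left _ _)
  · push Not at h
    exact (hlight P w b hb (fun p hp => ⟨(hw p hp).1, lt_of_le_of_ne (hw p hp).2 (h p hp)⟩)
      hbP).mono (le_max_right _ _) (le_max_right _ _)
end

section
/- There is a constant c = c(d) > 0 such that the following holds. Let P be a finite set of points in ℝ^d, let s be a service function, let ε ∈ (0,1), let k ≥ 1 be an integer, and set t = ⌈c/ε^{d+1}⌉. Suppose L ⊆ ℝ^d with |L| = k is locally optimal under exchanges of size t, i.e., for every finite set L' ⊆ ℝ^d with |L'| ≤ k, |L'∖L| ≤ t, and |L∖L'| ≤ t, one has ρ(L') ≤ ρ(L). Then ρ(L) ≥ (1−ε)·opt_k(P). -/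
open Metric Finset

/-- The distance of the coordinate vectors in the supremum norm. -/
noncomputable def supDist {d : ℕ} (x u : Pt d) : ℝ := dist (WithLp.ofLp u) (WithLp.ofLp x)

lemma supDist_le_iff {d : ℕ} {x u : Pt d} {r : ℝ} (hr : 0 ≤ r) :
    supDist x u ≤ r ↔ ∀ i, |u i - x i| ≤ r := by
  unfold supDist
  rw [dist_pi_le_iff hr]
  simp [Real.dist_eq]

lemma abs_coord_sub_le_supDist {d : ℕ} (x u : Pt d) (i : Fin d) : |u i - x i| ≤ supDist x u :=
  (supDist_le_iff dist_nonneg).1 le_rfl i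

lemma continuous_supDist {d : ℕ} (x : Pt d) : Continuous (supDist x) := by
  unfold supDist
  fun_prop

lemma abs_supDist_sub_le {d : ℕ} (x u v : Pt d) : |supDist x u - supDist x v| ≤ dist u v := by
  refine (abs_dist_sub_le _ _ _).trans ?_
  refine (dist_pi_le_iff dist_nonneg).2 fun i => ?_
  rw [Real.dist_eq, ← Real.norm_eq_abs, dist_eq_norm]
  exact PiLp.norm_apply_le (u - v) i

lemma exists_coord_eq_supDist {e : ℕ} (x u : Pt (e + 1)) : ∃ i, |u i - x i| = supDist x u := by
  obtain ⟨i, -, hi⟩ := Finset.exists_max_image Finset.univ (fun i => |u i - x i|)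
    Finset.univ_nonempty
  exact ⟨i, le_antisymm (abs_coord_sub_le_supDist x u i)
    ((supDist_le_iff (abs_nonneg _)).2 fun j => hi j (Finset.mem_univ j))⟩

lemma exists_mem_supDist_eq {d : ℕ} {x u v p : Pt d} {a : ℝ} (hu : supDist x u ≤ a)
    (hv : a ≤ supDist x v) :
    ∃ q y, (q = u ∨ q = v) ∧ supDist x y = a ∧ dist p y + dist y q = dist p q := by
  have key : ∀ q : Pt d, a ∈ Set.uIcc (supDist x p) (supDist x q) →
      ∃ y, supDist x y = a ∧ dist p y + dist y q = dist p q := by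
    intro q hq
    have hpre := (convex_segment (𝕜 := ℝ) p q).isPreconnected
    have hc := (continuous_supDist x).continuousOn (s := segment ℝ p q)
    have hmem : a ∈ supDist x '' segment ℝ p q := by
      rcases le_total (supDist x p) (supDist x q) with h | h
      · rw [Set.uIcc_of_le h] at hq
        exact hpre.intermediate_value (left_mem_segment ℝ p q) (right_mem_segment ℝ p q) hc hq
      · rw [Set.uIcc_of_ge h] at hq
        exact hpre.intermediate_value (right_mem_segment ℝ p q) (left_mem_segment ℝ p q) hc hq
    obtain ⟨y, hy, hya⟩ := hmem
    exact ⟨y, hya, dist_add_dist_of_mem_segment hy⟩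
  rcases le_total (supDist x p) a with h | h
  · obtain ⟨y, h1, h2⟩ := key v (Set.mem_uIcc_of_le h hv)
    exact ⟨v, y, Or.inr rfl, h1, h2⟩
  · obtain ⟨y, h1, h2⟩ := key u (Set.mem_uIcc_of_ge hu h)
    exact ⟨u, y, Or.inl rfl, h1, h2⟩

/-- The boundary of a cube of side length at most `4 * r` has a net of the expected size. -/
lemma exists_cube_boundary_net {e m : ℕ} (hm : 1 ≤ m) (x : Pt (e + 1)) {r a : ℝ} (hr : 0 < r)
    (ha : a ≤ 2 * r) :
    ∃ Q : Finset (Pt (e + 1)), Q.card ≤ 2 * (e + 1) * (17 * (e + 1)) ^ e * m ^ e ∧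
      ∀ y, supDist x y = a → ∃ q ∈ Q, dist y q ≤ r / (4 * m) := by
  have hm' : (0 : ℝ) < m := by exact_mod_cast hm
  set g : ℝ := r / (4 * m * (e + 1)) with hg
  have hgpos : 0 < g := by positivity
  set N : ℕ := 8 * m * (e + 1) with hN
  set S : Finset (Fin e → ℤ) := Fintype.piFinset fun _ => Finset.Icc (-N : ℤ) N with hS
  set F : (Fin (e + 1) × Bool) × (Fin e → ℤ) → Pt (e + 1) := fun w =>
    WithLp.toLp 2 (w.1.1.insertNth (x w.1.1 + (if w.1.2 then a else -a))
      (fun j => x (w.1.1.succAbove j) + g * w.2 j) : Fin (e + 1) → ℝ) with hF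
  refine ⟨(Finset.univ ×ˢ S).image F, ?_, ?_⟩
  · refine Finset.card_image_le.trans ?_
    have hcard : (2 * N + 1) ≤ 17 * (e + 1) * m := by
      rw [hN]; nlinarith [Nat.mul_le_mul hm (Nat.le_add_left 1 e)]
    have hcardS : S.card = (2 * N + 1) ^ e := by
      rw [hS, Fintype.card_piFinset_const, Int.card_Icc]
      congr 1
      omega
    rw [Finset.card_product, hcardS]
    simp only [Finset.card_univ, Fintype.card_prod, Fintype.card_fin, Fintype.card_bool]
    calc (e + 1) * 2 * (2 * N + 1) ^ e ≤ (e + 1) * 2 * (17 * (e + 1) * m) ^ e := by gcongr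
      _ = _ := by rw [mul_pow]; ring
  · intro y hy
    obtain ⟨i, hi⟩ := exists_coord_eq_supDist x y
    rw [hy] at hi
    obtain ⟨σ, hσ⟩ : ∃ σ : Bool, y i - x i = if σ then a else -a := by
      rcases abs_choice (y i - x i) with h | h
      · exact ⟨true, by simp [← hi, h]⟩
      · exact ⟨false, by simp [← hi, h]⟩
    set f : Fin e → ℤ := fun j => ⌊(y (i.succAbove j) - x (i.succAbove j)) / g⌋ with hf
    refine ⟨F ((i, σ), f), Finset.mem_image_of_mem F ?_, ?_⟩
    · refine Finset.mem_product.2 ⟨Finset.mem_univ _, Fintype.mem_piFinset.2 fun j => ?_⟩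
      have h1 : |y (i.succAbove j) - x (i.succAbove j)| ≤ 2 * r :=
        ((abs_coord_sub_le_supDist x y _).trans hy.le).trans ha
      have h2 : 2 * r = N * g := by
        rw [hN, hg]; push_cast; field_simp; ring
      rw [h2, abs_le] at h1
      rw [Finset.mem_Icc]
      constructor
      · refine Int.le_floor.2 ?_
        rw [le_div_iff₀ hgpos]
        push_cast
        linarith [h1.1]
      · have : (f j : ℝ) ≤ N := (Int.floor_le _).trans ((div_le_iff₀ hgpos).2 h1.2)
        exact_mod_cast this
    · have hco : ∀ j, |y j - F ((i, σ), f) j| ≤ g := by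
        intro j
        rcases Fin.eq_self_or_eq_succAbove i j with rfl | ⟨j, rfl⟩
        · have : F ((j, σ), f) j = y j := by
            simp only [hF, Fin.insertNth_apply_same, ← hσ]
            ring
          rw [this]; simpa using hgpos.le
        · have : F ((i, σ), f) (i.succAbove j) = x (i.succAbove j) + g * f j := by
            simp only [hF, Fin.insertNth_apply_succAbove]
          rw [this]
          have h1 := Int.floor_le ((y (i.succAbove j) - x (i.succAbove j)) / g)
          have h2 := Int.lt_floor_add_one ((y (i.succAbove j) - x (i.succAbove j)) / g)
          rw [le_div_iff₀ hgpos] at h1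
          rw [div_lt_iff₀ hgpos] at h2
          rw [abs_le]
          constructor <;> simp only [hf] <;> nlinarith
      rw [EuclideanSpace.dist_eq, Real.sqrt_le_iff]
      refine ⟨by positivity, ?_⟩
      calc ∑ j, dist (y j) (F ((i, σ), f) j) ^ 2 ≤ ∑ j : Fin (e + 1), g ^ 2 := by
            refine Finset.sum_le_sum fun j _ => ?_
            rw [Real.dist_eq]
            exact pow_le_pow_left₀ (abs_nonneg _) (hco j) 2
        _ = (e + 1) * g ^ 2 := by simp
        _ ≤ ((e + 1) * g) ^ 2 := by
            rw [mul_pow]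
            gcongr
            nlinarith [(Nat.cast_nonneg e : (0 : ℝ) ≤ e)]
        _ = (r / (4 * m)) ^ 2 := by
            rw [hg]; congr 1; field_simp

/-- A scale at which some cube is rich in points of `U` but no cube of half the size is. -/
lemma exists_critical_scale {d B : ℕ} (hB : 2 ≤ B) {U : Finset (Pt d)} (hU : B ≤ U.card) :
    ∃ r > 0, ∃ x : Pt d, B ≤ (U.filter fun u => supDist x u ≤ r).card ∧
      ∀ y : Pt d, (U.filter fun u => supDist y u ≤ r / 2).card < B := by
  have hpos : ∀ u ∈ U, ∀ v ∈ U, u ≠ v → 0 < supDist u v := by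
    intro u _ v _ huv
    refine dist_pos.2 fun h => huv ?_
    exact (WithLp.ofLp_injective 2 h).symm
  obtain ⟨δ, hδ, hsep⟩ : ∃ δ > 0, ∀ u ∈ U, ∀ v ∈ U, u ≠ v → δ ≤ supDist u v := by
    have hne : U.offDiag.Nonempty := by
      obtain ⟨u, hu, v, hv, huv⟩ := Finset.one_lt_card.1 (by omega : 1 < U.card)
      exact ⟨(u, v), Finset.mem_offDiag.2 ⟨hu, hv, huv⟩⟩
    obtain ⟨w, hw, hmin⟩ := Finset.exists_min_image U.offDiag (fun w => supDist w.1 w.2) hne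
    rw [Finset.mem_offDiag] at hw
    exact ⟨_, hpos _ hw.1 _ hw.2.1 hw.2.2, fun u hu v hv huv =>
      hmin (u, v) (Finset.mem_offDiag.2 ⟨hu, hv, huv⟩)⟩
  obtain ⟨R, hR, hbig⟩ : ∃ R > 0, ∀ u ∈ U, supDist 0 u ≤ R := by
    refine ⟨1 + ∑ u ∈ U, supDist 0 u, ?_, fun u hu => ?_⟩
    · have : 0 ≤ ∑ u ∈ U, supDist 0 u := Finset.sum_nonneg fun u _ => dist_nonneg
      linarith
    · have := Finset.single_le_sum (f := fun u => supDist (0 : Pt d) u)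
        (fun u _ => dist_nonneg) hu
      linarith
  have hex : ∃ n : ℕ, ∀ y : Pt d, (U.filter fun u => supDist y u ≤ R / 2 ^ n).card < B := by
    obtain ⟨n, hn⟩ := exists_pow_lt_of_lt_one (div_pos hδ (mul_pos two_pos hR))
      (by norm_num : (1 / 2 : ℝ) < 1)
    refine ⟨n, fun y => lt_of_le_of_lt (b := 1) (Finset.card_le_one.2 fun u hu v hv => ?_)
      (by omega)⟩
    rw [Finset.mem_filter] at hu hv
    by_contra huv
    have h1 := hsep u hu.1 v hv.1 huv
    have h2 : supDist u v ≤ supDist y v + supDist y u := dist_triangle_right _ _ _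
    have h3 : 2 * (R / 2 ^ n) < δ := by
      rw [lt_div_iff₀ (by positivity), one_div, inv_pow] at hn
      rw [div_eq_mul_inv]
      linarith
    linarith [hu.2, hv.2]
  classical
  obtain ⟨n, hn⟩ : ∃ n, Nat.find hex = n + 1 := by
    refine Nat.exists_eq_succ_of_ne_zero fun h0 => ?_
    have h := Nat.find_spec hex 0
    rw [h0, pow_zero, div_one, Finset.filter_true_of_mem hbig] at h
    omega
  have h1 := Nat.find_spec hex
  have h2 := Nat.find_min hex (m := n) (by omega)
  push Not at h2
  obtain ⟨x, hx⟩ := h2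
  refine ⟨R / 2 ^ n, by positivity, x, hx, fun y => ?_⟩
  have := h1 y
  rwa [hn, pow_succ, ← div_div] at this

lemma card_cube_le {d B : ℕ} {U : Finset (Pt d)} {r : ℝ} (hr : 0 < r)
    (h : ∀ y : Pt d, (U.filter fun u => supDist y u ≤ r / 2).card < B) (x : Pt d) :
    (U.filter fun u => supDist x u ≤ 2 * r).card ≤ 5 ^ d * B := by
  set f : Pt d → Fin d → ℤ := fun u i => ⌊(u i - x i) / r⌋ with hf
  set T : Finset (Fin d → ℤ) := Fintype.piFinset fun _ => Finset.Icc (-2) 2 with hT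
  have hTc : T.card = 5 ^ d := by
    rw [hT, Fintype.card_piFinset_const, Int.card_Icc]
    simp
  rw [← hTc, mul_comm T.card]
  refine Finset.card_le_mul_card_image_of_maps_to (f := f) (fun u hu => ?_) _ fun b _ => ?_
  · rw [Finset.mem_filter, supDist_le_iff (by positivity)] at hu
    refine Fintype.mem_piFinset.2 fun i => Finset.mem_Icc.2 ?_
    have h1 := abs_le.1 (hu.2 i)
    constructor
    · refine Int.le_floor.2 ?_
      rw [le_div_iff₀ hr]
      push_cast
      linarith [h1.1]
    · have : (f u i : ℝ) ≤ 2 := (Int.floor_le _).trans ((div_le_iff₀ hr).2 h1.2)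
      exact_mod_cast this
  · refine le_trans (Finset.card_le_card fun u hu => ?_)
      (h (WithLp.toLp 2 fun i => x i + (b i + 1 / 2) * r)).le
    rw [Finset.mem_filter, Finset.mem_filter] at hu
    rw [Finset.mem_filter, supDist_le_iff (by positivity)]
    refine ⟨hu.1.1, fun i => ?_⟩
    have hb : ⌊(u i - x i) / r⌋ = b i := congrFun hu.2 i
    have h1 := Int.floor_le ((u i - x i) / r)
    have h2 := Int.lt_floor_add_one ((u i - x i) / r)
    rw [hb, le_div_iff₀ hr] at h1
    rw [hb, div_lt_iff₀ hr] at h2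
    rw [abs_le]
    constructor <;> simp only <;> linarith

/-- The implied constant in the size of a separator in dimension `e + 1`. -/
def sepConst (e : ℕ) : ℕ := 5 ^ (e + 1) + 2 * (e + 1) * (17 * (e + 1)) ^ e

lemma one_le_sepConst (e : ℕ) : 1 ≤ sepConst e :=
  le_add_right (Nat.one_le_pow _ _ (by norm_num))

/-- A cube containing about `m ^ (e + 1)` points of `U`, and `O(m ^ e)` points separating it from
the rest of `U`. -/
lemma exists_separator {e m : ℕ} (hm : 2 ≤ m) {U : Finset (Pt (e + 1))}
    (hU : m ^ (e + 1) ≤ U.card) :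
    ∃ A ⊆ U, ∃ Z : Finset (Pt (e + 1)), m ^ (e + 1) ≤ A.card ∧
      A.card ≤ 5 ^ (e + 1) * m ^ (e + 1) ∧ Z.card ≤ sepConst e * m ^ e ∧
      ∀ u ∈ A, ∀ v ∈ U, v ∉ A → ∀ p, ∃ z ∈ Z, dist p z ≤ max (dist p u) (dist p v) := by
  have hm0 : (0 : ℝ) < m := by exact_mod_cast (by omega : 0 < m)
  obtain ⟨r, hr, x, hx, hsmall⟩ := exists_critical_scale
    (hm.trans (Nat.le_self_pow (Nat.succ_ne_zero e) m)) hU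
  have hcube := card_cube_le hr hsmall x
  set V := U.filter fun u => supDist x u ≤ 2 * r with hV
  set f : Pt (e + 1) → ℤ := fun u => ⌊m * (supDist x u / r - 1)⌋ with hf
  obtain ⟨j, hj, hjc⟩ : ∃ j ∈ Finset.Ico (0 : ℤ) m,
      (V.filter fun u => f u = j).card ≤ 5 ^ (e + 1) * m ^ e := by
    refine Finset.exists_card_fiber_le_of_card_le_mul ⟨0, by simp; omega⟩ ?_
    rw [Int.card_Ico]
    simp only [sub_zero, Int.toNat_natCast]
    calc V.card ≤ 5 ^ (e + 1) * m ^ (e + 1) := hcube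
      _ = _ := by rw [pow_succ m]; ring
  rw [Finset.mem_Ico] at hj
  have hj0 : (0 : ℝ) ≤ j := by exact_mod_cast hj.1
  have hj1 : (j : ℝ) + 1 ≤ m := by exact_mod_cast hj.2
  set a : ℝ := r * (1 + (2 * j + 1) / (2 * m)) with ha
  have hfrac : (2 * j + 1) / (2 * m : ℝ) + 1 / (4 * m) ≤ 1 := by
    rw [div_add_div _ _ (by positivity) (by positivity), div_le_one (by positivity)]
    nlinarith
  have har : r ≤ a := by
    have : 0 ≤ (2 * j + 1) / (2 * m : ℝ) := by positivity
    nlinarith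
  have ha2 : a + r / (4 * m) ≤ 2 * r := by
    have : r / (4 * m) = r * (1 / (4 * m)) := by ring
    rw [this, ha]
    nlinarith
  have hl : 0 < r / (4 * m) := by positivity
  obtain ⟨Q, hQ, hnet⟩ := exists_cube_boundary_net (by omega : 1 ≤ m) x hr
    (by linarith : a ≤ 2 * r)
  refine ⟨U.filter fun u => supDist x u ≤ a, Finset.filter_subset _ _,
    (V.filter fun u => f u = j) ∪ Q, hx.trans (Finset.card_le_card ?_),
    (Finset.card_le_card ?_).trans hcube, ?_, ?_⟩
  · exact Finset.monotone_filter_right U fun u _ hu => le_trans hu har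
  · exact Finset.monotone_filter_right U fun u _ hu => le_trans hu (by linarith)
  · refine (Finset.card_union_le _ _).trans ((add_le_add hjc hQ).trans ?_)
    rw [sepConst, add_mul]
  · intro u hu v hv hvA p
    rw [Finset.mem_filter] at hu
    have hva : a ≤ supDist x v := by
      by_contra hlt
      exact hvA (Finset.mem_filter.2 ⟨hv, (not_le.1 hlt).le⟩)
    obtain ⟨q, y, hq, hy, hpq⟩ := exists_mem_supDist_eq (p := p) hu.2 hva
    have hqU : q ∈ U := by rcases hq with rfl | rfl; exacts [hu.1, hv]
    have hqd : dist p q ≤ max (dist p u) (dist p v) := by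
      rcases hq with rfl | rfl
      exacts [le_max_left _ _, le_max_right _ _]
    rcases le_total (dist y q) (r / (4 * m)) with hyq | hyq
    · refine ⟨q, Finset.mem_union_left _ (Finset.mem_filter.2 ⟨?_, ?_⟩), hqd⟩
      · have := abs_le.1 ((abs_supDist_sub_le x y q).trans hyq)
        exact Finset.mem_filter.2 ⟨hqU, by linarith⟩
      · have h := abs_le.1 ((abs_supDist_sub_le x y q).trans hyq)
        rw [hy] at h
        have e1 : m * (a / r - 1) = j + 1 / 2 := by
          rw [ha]; field_simp; ring
        have e2 : m * ((a + r / (4 * m)) / r - 1) = j + 3 / 4 := by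
          rw [add_div, add_sub_right_comm, mul_add, e1]; field_simp; ring
        have e3 : m * ((a - r / (4 * m)) / r - 1) = j + 1 / 4 := by
          rw [sub_div, sub_right_comm, mul_sub, e1]; field_simp; ring
        refine Int.floor_eq_iff.2 ⟨?_, ?_⟩
        · have : m * ((a - r / (4 * m)) / r - 1) ≤ m * (supDist x q / r - 1) := by
            gcongr; linarith
          linarith
        · have : m * (supDist x q / r - 1) ≤ m * ((a + r / (4 * m)) / r - 1) := by
            gcongr; linarith
          linarith
    · obtain ⟨z, hz, hyz⟩ := hnet y hy
      refine ⟨z, Finset.mem_union_right _ hz, ?_⟩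
      calc dist p z ≤ dist p y + dist y z := dist_triangle _ _ _
        _ ≤ dist p y + dist y q := by gcongr; exact hyz.trans hyq
        _ ≤ _ := hpq.trans_le hqd

/-- A division of a finite set into few-point clusters `{u ∈ U | cl u = i}`, each of which is
separated from all the others by a set `W i`, with few separating points in total. -/
lemma exists_division {e m : ℕ} (hm : 2 * sepConst e ≤ m) (U : Finset (Pt (e + 1))) :
    ∃ (cl : Pt (e + 1) → ℕ) (n : ℕ) (W : ℕ → Finset (Pt (e + 1))),
      (∀ u ∈ U, cl u < n) ∧
      (∀ i < n, ((U.filter fun u => cl u = i) ∪ W i).card ≤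
        (5 ^ (e + 1) + sepConst e) * m ^ (e + 1)) ∧
      m * ∑ i ∈ Finset.range n, (W i).card ≤ 4 * sepConst e * U.card ∧
      ∀ u ∈ U, ∀ v ∈ U, cl u ≠ cl v → ∀ p, ∃ w ∈ W (cl v),
        dist p w ≤ max (dist p u) (dist p v) := by
  induction hN : U.card using Nat.strong_induction_on generalizing U with
  | _ N ih =>
  subst hN
  have hK := one_le_sepConst e
  rcases lt_or_ge U.card (m ^ (e + 1)) with hU | hU
  · refine ⟨fun _ => 0, 1, fun _ => ∅, fun _ _ => one_pos, fun i _ => ?_, by simp, ?_⟩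
    · rw [Finset.union_empty]
      refine (Finset.card_filter_le _ _).trans (hU.le.trans ?_)
      exact Nat.le_mul_of_pos_left _ (Nat.add_pos_right _ hK)
    · intro u _ v _ h
      exact absurd rfl h
  · obtain ⟨A, hAU, Z, hA1, hA2, hZ, hsep⟩ := exists_separator (by omega : 2 ≤ m) hU
    have hZ2 : 2 * Z.card ≤ m ^ (e + 1) := by
      calc 2 * Z.card ≤ 2 * sepConst e * m ^ e := by rw [mul_assoc]; gcongr
        _ ≤ m * m ^ e := by gcongr
        _ = m ^ (e + 1) := by ring
    have hpow : 1 ≤ m ^ (e + 1) := Nat.one_le_pow _ _ (by omega)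
    have hU' : ((U \ A) ∪ Z).card + A.card ≤ U.card + Z.card := by
      have h1 := Finset.card_union_le (U \ A) Z
      have h2 := Finset.card_sdiff_add_card_eq_card hAU
      omega
    obtain ⟨cl, n, W, hcl, hcard, hsum, hdist⟩ := ih _ (by omega) ((U \ A) ∪ Z) rfl
    have hZm : ∀ z ∈ Z, z ∈ (U \ A) ∪ Z := fun z hz => Finset.mem_union_right _ hz
    have hUm : ∀ u ∈ U, u ∉ A → u ∈ (U \ A) ∪ Z := fun u hu hA =>
      Finset.mem_union_left _ (Finset.mem_sdiff.2 ⟨hu, hA⟩)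
    classical
    refine ⟨fun u => if u ∈ A then 0 else cl u + 1, n + 1,
      fun i => Nat.casesOn i Z fun i => W i ∪ Z.filter fun z => cl z = i, ?_, ?_, ?_, ?_⟩
    · intro u hu
      by_cases h : u ∈ A
      · simp [h]
      · simpa [h] using hcl u (hUm u hu h)
    · rintro (_ | i) hi
      · refine (Finset.card_union_le _ _).trans ?_
        rw [add_mul]
        refine add_le_add (le_trans (Finset.card_le_card fun u hu => ?_) hA2)
          (hZ.trans ?_)
        · rw [Finset.mem_filter] at hu
          by_contra h
          simp [h] at hu
        · gcongr <;> omega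
      · refine le_trans (Finset.card_le_card fun u hu => ?_) (hcard i (by omega))
        simp only [Finset.mem_union, Finset.mem_filter] at hu ⊢
        rcases hu with ⟨hu, h⟩ | hu | hu
        · by_cases hA : u ∈ A
          · simp [hA] at h
          · simp only [hA, if_false, Nat.add_right_cancel_iff] at h
            exact Or.inl ⟨Finset.mem_union.1 (hUm u hu hA), h⟩
        · exact Or.inr hu
        · exact Or.inl ⟨Or.inr hu.1, hu.2⟩
    · rw [Finset.sum_range_succ']
      have hfib : ∑ i ∈ Finset.range n, (Z.filter fun z => cl z = i).card = Z.card :=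
        (Finset.card_eq_sum_card_fiberwise fun z hz =>
          Finset.mem_coe.2 (Finset.mem_range.2 (hcl z (hZm z hz)))).symm
      have h1 : ∑ i ∈ Finset.range n, (W i ∪ Z.filter fun z => cl z = i).card ≤
          ∑ i ∈ Finset.range n, (W i).card + Z.card := by
        rw [← hfib, ← Finset.sum_add_distrib]
        exact Finset.sum_le_sum fun i _ => Finset.card_union_le _ _
      have hmZ : m * Z.card ≤ sepConst e * m ^ (e + 1) := by
        calc m * Z.card ≤ m * (sepConst e * m ^ e) := by gcongr
          _ = _ := by ring
      have h2 := Nat.mul_le_mul_left (4 * sepConst e) hU'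
      have h3 := Nat.mul_le_mul_left (4 * sepConst e) hA1
      have h4 := Nat.mul_le_mul_left (2 * sepConst e) hZ2
      have h5 := Nat.mul_le_mul_left m h1
      change m * (∑ i ∈ Finset.range n, (W i ∪ Z.filter fun z => cl z = i).card + Z.card) ≤ _
      nlinarith
    · intro u hu v hv huv p
      by_cases hvA : v ∈ A <;> by_cases huA : u ∈ A
      · simp [hvA, huA] at huv
      · obtain ⟨z, hz, h⟩ := hsep v hvA u hu huA p
        exact ⟨z, by simpa [hvA] using hz, by rwa [max_comm]⟩
      · obtain ⟨z, hz, h⟩ := hsep u huA v hv hvA p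
        by_cases hzv : cl z = cl v
        · exact ⟨z, by simp [hvA, hz, hzv], h⟩
        · obtain ⟨w, hw, h'⟩ := hdist z (hZm z hz) v (hUm v hv hvA) hzv p
          exact ⟨w, by simp [hvA, hw], h'.trans (max_le h (le_max_right _ _))⟩
      · obtain ⟨w, hw, h'⟩ := hdist u (hUm u hu huA) v (hUm v hv hvA)
          (by simpa [hvA, huA] using huv) p
        exact ⟨w, by simp [hvA, hw], h'⟩

lemma exists_balanced_subset {ι : Type*} [DecidableEq ι] {I : Finset ι} {u w : ι → ℝ}
    {a D T M : ℝ} (hu : ∀ i ∈ I, |u i| ≤ D) (hw : ∀ i ∈ I, w i ≤ M) (hT : 0 ≤ T) (hM : 0 ≤ M)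
    (ha : |a| ≤ D) (hsum : a + ∑ i ∈ I, u i = 0) (hI : T ≤ ∑ i ∈ I, w i) :
    ∃ G ⊆ I, |a + ∑ i ∈ G, u i| ≤ D ∧ T ≤ ∑ i ∈ G, w i ∧ ∑ i ∈ G, w i ≤ T + M := by
  obtain ⟨G, hG, hmax⟩ := Finset.exists_max_image
    (I.powerset.filter fun G => |a + ∑ i ∈ G, u i| ≤ D ∧ ∑ i ∈ G, w i ≤ T + M) Finset.card
    ⟨∅, by simp only [Finset.mem_filter, Finset.empty_mem_powerset, Finset.sum_empty, add_zero,
      true_and]; exact ⟨ha, by positivity⟩⟩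
  simp only [Finset.mem_filter, Finset.mem_powerset] at hG hmax
  obtain ⟨hGI, hGa, hGw⟩ := hG
  refine ⟨G, hGI, hGa, ?_, hGw⟩
  by_contra! hlt
  have hrest : a + ∑ i ∈ G, u i + ∑ i ∈ I \ G, u i = 0 := by
    rw [← hsum, ← Finset.sum_sdiff hGI]; ring
  have hne : (I \ G).Nonempty := by
    rw [Finset.nonempty_iff_ne_empty]
    intro h
    rw [Finset.sdiff_eq_empty_iff_subset] at h
    rw [Finset.Subset.antisymm hGI h] at hlt
    linarith
  obtain ⟨j, hj, hja⟩ : ∃ j ∈ I \ G, |a + ∑ i ∈ G, u i + u j| ≤ D := by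
    rcases le_total 0 (a + ∑ i ∈ G, u i) with h | h
    · obtain ⟨j, hj, hj0⟩ := Finset.exists_le_of_sum_le (f := u) (g := fun _ => 0) hne
        (by simp only [Finset.sum_const_zero]; linarith)
      refine ⟨j, hj, abs_le.2 ?_⟩
      have := abs_le.1 (hu j (Finset.mem_sdiff.1 hj).1)
      have := abs_le.1 hGa
      constructor <;> linarith
    · obtain ⟨j, hj, hj0⟩ := Finset.exists_le_of_sum_le (f := fun _ => 0) (g := u) hne
        (by simp only [Finset.sum_const_zero]; linarith)
      refine ⟨j, hj, abs_le.2 ?_⟩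
      have := abs_le.1 (hu j (Finset.mem_sdiff.1 hj).1)
      have := abs_le.1 hGa
      constructor <;> linarith
  rw [Finset.mem_sdiff] at hj
  have := hmax (insert j G) ⟨Finset.insert_subset hj.1 hGI, by
    rw [Finset.sum_insert hj.2, add_comm (u j), ← add_assoc]; exact hja, by
    rw [Finset.sum_insert hj.2]; linarith [hw j hj.1]⟩
  rw [Finset.card_insert_of_notMem hj.2] at this
  omega

lemma exists_balanced_partition {ι : Type*} {I : Finset ι} {u w : ι → ℝ}
    {a D T M : ℝ} (hu : ∀ i ∈ I, |u i| ≤ D) (hw : ∀ i ∈ I, w i ≤ M)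
    (hT : 0 < T) (hM : 0 ≤ M) (ha : |a| ≤ D) (hsum : a + ∑ i ∈ I, u i = 0)
    (hI : T ≤ ∑ i ∈ I, w i) :
    ∃ (blk : ι → ℕ) (n : ℕ), (∀ i ∈ I, blk i < n) ∧ ∀ b < n,
      -(2 * D) ≤ ∑ i ∈ I with blk i = b, u i ∧ T ≤ ∑ i ∈ I with blk i = b, w i ∧
        ∑ i ∈ I with blk i = b, w i ≤ 2 * T + M := by
  classical
  induction hN : I.card using Nat.strong_induction_on generalizing I a with
  | _ N ih =>
  subst hN
  rcases le_or_gt (∑ i ∈ I, w i) (2 * T + M) with hle | hgt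
  · refine ⟨fun _ => 0, 1, fun _ _ => one_pos, fun b hb => ?_⟩
    obtain rfl : b = 0 := by omega
    simp only [Finset.filter_true]
    have := abs_le.1 ha
    exact ⟨by linarith, hI, hle⟩
  · obtain ⟨G, hG, hGa, hGT, hGM⟩ := exists_balanced_subset hu hw hT.le hM ha hsum hI
    have hne : G.Nonempty := by
      rw [Finset.nonempty_iff_ne_empty]
      rintro rfl
      simp at hGT
      linarith
    have hsw := Finset.sum_sdiff (f := w) hG
    have hsu := Finset.sum_sdiff (f := u) hG
    have hlt : (I \ G).card < I.card := by
      have := Finset.card_sdiff_add_card_eq_card hG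
      have := hne.card_pos
      omega
    obtain ⟨blk, n, hn, hb⟩ := ih _ hlt (I := I \ G) (a := a + ∑ i ∈ G, u i)
      (fun i hi => hu i (Finset.mem_sdiff.1 hi).1) (fun i hi => hw i (Finset.mem_sdiff.1 hi).1)
      hGa (by linarith) (by linarith) rfl
    refine ⟨fun i => if i ∈ G then 0 else blk i + 1, n + 1, fun i hi => ?_, ?_⟩
    · by_cases h : i ∈ G
      · simp [h]
      · simpa [h] using hn i (Finset.mem_sdiff.2 ⟨hi, h⟩)
    · rintro (_ | b) hbn
      · have : (I.filter fun i => (if i ∈ G then 0 else blk i + 1) = 0) = G := by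
          ext i
          by_cases h : i ∈ G
          · simp [h, hG h]
          · simp [h]
        rw [this]
        have h1 := abs_le.1 ha
        have h2 := abs_le.1 hGa
        exact ⟨by linarith, hGT, by linarith⟩
      · have : (I.filter fun i => (if i ∈ G then 0 else blk i + 1) = b + 1) =
            (I \ G).filter fun i => blk i = b := by
          ext i
          by_cases h : i ∈ G <;> simp [h]
        rw [this]
        exact hb b (by omega)

section Profit

variable {d : ℕ} {P : Finset (Pt d)} {s : ℝ → ℝ}

lemma exists_infDist_eq_dist {C : Finset (Pt d)} (hC : C.Nonempty) (p : Pt d) :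
    ∃ c ∈ C, Metric.infDist p (C : Set (Pt d)) = dist p c :=
  C.finite_toSet.isCompact.exists_infDist_eq_dist (Finset.coe_nonempty.2 hC) p

lemma profit_nonneg (hs : IsServiceFunction s) (C : Finset (Pt d)) : 0 ≤ profit P s C := by
  unfold profit
  split_ifs
  · exact Finset.sum_nonneg fun p _ => hs.1 _ Metric.infDist_nonneg
  · exact le_rfl

lemma profit_eq {C : Finset (Pt d)} (hC : C.Nonempty) :
    profit P s C = ∑ p ∈ P, s (Metric.infDist p (C : Set (Pt d))) := if_pos hC

lemma le_profit (hs : IsServiceFunction s) {C : Finset (Pt d)} {f : Pt d → ℝ}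
    (h : ∀ p ∈ P, ∃ c ∈ C, f p ≤ s (dist p c)) : ∑ p ∈ P, f p ≤ profit P s C := by
  rcases P.eq_empty_or_nonempty with rfl | ⟨p, hp⟩
  · simp [profit]
  · obtain ⟨c, hc, -⟩ := h p hp
    rw [profit_eq ⟨c, hc⟩]
    refine Finset.sum_le_sum fun p hp => ?_
    obtain ⟨c, hc, hf⟩ := h p hp
    exact hf.trans (hs.2 _ _ Metric.infDist_nonneg (Metric.infDist_le_dist_of_mem hc))

lemma exists_subset_card_mul_sum_le {ι : Type*} (a : ι → ℝ) (O : Finset ι) {j : ℕ}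
    (hj : j ≤ O.card) :
    ∃ O' ⊆ O, O'.card = j ∧ (j : ℝ) * ∑ o ∈ O, a o ≤ O.card * ∑ o ∈ O', a o := by
  classical
  induction hn : O.card - j generalizing O with
  | zero => exact ⟨O, subset_rfl, by omega, by rw [show O.card = j by omega]⟩
  | succ n ih =>
    have hO : O.Nonempty := Finset.card_pos.1 (by omega)
    obtain ⟨o, ho, hmin⟩ := Finset.exists_min_image O a hO
    have hc := Finset.card_erase_add_one ho
    obtain ⟨O', hO', hcard, hsum⟩ := ih (O.erase o) (by omega) (by omega)
    refine ⟨O', hO'.trans (Finset.erase_subset _ _), hcard, ?_⟩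
    have hsplit := Finset.sum_erase_add O a ho
    have havg : O.card * a o ≤ ∑ o ∈ O, a o := by
      have := Finset.card_nsmul_le_sum O a (a o) hmin
      rwa [nsmul_eq_mul] at this
    have hc' : (O.card : ℝ) = (O.erase o).card + 1 := by exact_mod_cast hc.symm
    rcases Nat.eq_zero_or_pos (O.erase o).card with h0 | h0
    · have hj0 : j = 0 := by omega
      subst hj0
      simp [Finset.card_eq_zero.1 hcard]
    · have h0' : (0 : ℝ) < (O.erase o).card := by exact_mod_cast h0
      have hj0 : (0 : ℝ) ≤ j := Nat.cast_nonneg j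
      rw [hc'] at havg ⊢
      set q : ℝ := ((O.erase o).card : ℝ)
      have h1 : q * ∑ o ∈ O, a o ≤ (q + 1) * ∑ x ∈ O.erase o, a x := by
        rw [← hsplit] at havg ⊢
        linarith
      refine le_of_mul_le_mul_left ?_ h0'
      calc q * (j * ∑ o ∈ O, a o) = j * (q * ∑ o ∈ O, a o) := by ring
        _ ≤ j * ((q + 1) * ∑ x ∈ O.erase o, a x) := by gcongr
        _ = (q + 1) * (j * ∑ x ∈ O.erase o, a x) := by ring
        _ ≤ (q + 1) * (q * ∑ x ∈ O', a x) := by gcongr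
        _ = _ := by ring

/-- Some subset of `j` centers retains the fraction `j / |O|` of the profit of `O`. -/
lemma exists_subset_card_mul_profit_le (hs : IsServiceFunction s) {O : Finset (Pt d)} {j : ℕ}
    (hj : j ≤ O.card) :
    ∃ O' ⊆ O, O'.card = j ∧ (j : ℝ) * profit P s O ≤ O.card * profit P s O' := by
  rcases O.eq_empty_or_nonempty with rfl | hO
  · exact ⟨∅, subset_rfl, by simpa [eq_comm] using hj, by simp [profit]⟩
  choose o hoO hod using exists_infDist_eq_dist hO
  obtain ⟨O', hO', hcard, hsum⟩ := exists_subset_card_mul_sum_le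
    (fun c => ∑ p ∈ P with o p = c, s (dist p (o p))) O hj
  refine ⟨O', hO', hcard, ?_⟩
  have h1 : profit P s O = ∑ c ∈ O, ∑ p ∈ P with o p = c, s (dist p (o p)) := by
    rw [profit_eq hO, Finset.sum_fiberwise_of_maps_to fun p _ => hoO p]
    simp only [hod]
  have h2 : ∑ c ∈ O', ∑ p ∈ P with o p = c, s (dist p (o p)) ≤ profit P s O' := by
    rcases O'.eq_empty_or_nonempty with rfl | ⟨c₀, hc₀⟩
    · simp [profit]
    · have : ∑ c ∈ O', ∑ p ∈ P with o p = c, s (dist p (o p)) =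
          ∑ p ∈ P, if o p ∈ O' then s (dist p (o p)) else 0 := by
        simp only [Finset.sum_filter]
        rw [Finset.sum_comm]
        simp
      rw [this]
      refine le_profit hs fun p _ => ?_
      split_ifs with h
      · exact ⟨o p, h, le_rfl⟩
      · exact ⟨c₀, hc₀, hs.1 _ dist_nonneg⟩
  rw [h1]
  exact hsum.trans (by gcongr)

/-- If `L ∪ O` splits into separated clusters in each of which `O` and the separating points can be
exchanged for `L`, then local optimality of `L` gives `ρ(O) ≤ ρ(L)`. -/
lemma profit_le_of_division (hs : IsServiceFunction s) {k t : ℕ} {L O : Finset (Pt d)}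
    (hL : L.card = k) (hLne : L.Nonempty)
    (hopt : ∀ L' : Finset (Pt d), L'.card ≤ k → (L' \ L).card ≤ t → (L \ L').card ≤ t →
      profit P s L' ≤ profit P s L)
    {cl : Pt d → ℕ} {n : ℕ} {W : ℕ → Finset (Pt d)} (hcl : ∀ u ∈ L ∪ O, cl u < n)
    (hbal : ∀ b < n, (O.filter fun u => cl u = b).card + (W b).card ≤
      (L.filter fun u => cl u = b).card)
    (ht : ∀ b < n, (L.filter fun u => cl u = b).card ≤ t)
    (hsep : ∀ u ∈ L ∪ O, ∀ v ∈ L ∪ O, cl u ≠ cl v → ∀ p, ∃ w ∈ W (cl v),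
      dist p w ≤ max (dist p u) (dist p v)) :
    profit P s O ≤ profit P s L := by
  rcases O.eq_empty_or_nonempty with rfl | hO
  · simpa [profit] using profit_nonneg hs L
  choose o hoO hod using exists_infDist_eq_dist hO
  choose l hlL hld using exists_infDist_eq_dist hLne
  set sO : Pt d → ℝ := fun p => s (dist p (o p)) with hsO
  set sL : Pt d → ℝ := fun p => s (dist p (l p)) with hsL
  have hPO : profit P s O = ∑ p ∈ P, sO p := by simp only [profit_eq hO, hod, hsO]
  have hPL : profit P s L = ∑ p ∈ P, sL p := by simp only [profit_eq hLne, hld, hsL]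
  have hlU : ∀ p, l p ∈ L ∪ O := fun p => Finset.mem_union_left _ (hlL p)
  have hoU : ∀ p, o p ∈ L ∪ O := fun p => Finset.mem_union_right _ (hoO p)
  set f : ℕ → Pt d → ℝ := fun b p => sL p + (if cl (o p) = b then max (sO p - sL p) 0 else 0) +
    (if cl (l p) = b then min (sO p - sL p) 0 else 0) with hf
  have hswap : ∀ b < n, ∑ p ∈ P, f b p ≤ profit P s L := by
    intro b hb
    set Lb := L.filter fun u => cl u = b with hLb
    set Ob := O.filter fun u => cl u = b with hOb
    have hbb := hbal b hb
    have hadd : (Ob ∪ W b).card ≤ Lb.card := (Finset.card_union_le _ _).trans hbb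
    refine le_trans (le_profit hs fun p _ => ?_)
      (hopt ((L \ Lb) ∪ (Ob ∪ W b)) ?_ ?_ ?_)
    · have hmemL : cl (l p) ≠ b → l p ∈ (L \ Lb) ∪ (Ob ∪ W b) := fun h =>
        Finset.mem_union_left _ (Finset.mem_sdiff.2 ⟨hlL p, fun h' =>
          h (Finset.mem_filter.1 h').2⟩)
      have hmemO : cl (o p) = b → o p ∈ (L \ Lb) ∪ (Ob ∪ W b) := fun h =>
        Finset.mem_union_right _ (Finset.mem_union_left _ (Finset.mem_filter.2 ⟨hoO p, h⟩))
      by_cases ho : cl (o p) = b <;> by_cases hl : cl (l p) = b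
      · refine ⟨o p, hmemO ho, ?_⟩
        simp only [hf, ho, hl, if_true]
        change _ ≤ sO p
        rw [add_assoc, max_add_min]
        linarith
      · simp only [hf, ho, hl, if_true, if_false, add_zero]
        rcases le_total (sO p) (sL p) with h | h
        · refine ⟨l p, hmemL hl, ?_⟩
          rw [max_eq_right (by linarith), add_zero]
        · refine ⟨o p, hmemO ho, ?_⟩
          rw [max_eq_left (by linarith)]
          change _ ≤ sO p
          linarith
      · obtain ⟨w, hw, hwd⟩ := hsep (o p) (hoU p) (l p) (hlU p) (fun h => ho (h.trans hl)) p
        rw [hl] at hw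
        refine ⟨w, Finset.mem_union_right _ (Finset.mem_union_right _ hw), ?_⟩
        refine le_trans ?_ (hs.2 _ _ dist_nonneg hwd)
        simp only [hf, ho, hl, if_true, if_false, add_zero]
        have h1 : sL p + min (sO p - sL p) 0 ≤ sL p := by linarith [min_le_right (sO p - sL p) 0]
        have h2 : sL p + min (sO p - sL p) 0 ≤ sO p := by linarith [min_le_left (sO p - sL p) 0]
        rcases max_choice (dist p (o p)) (dist p (l p)) with h | h <;> rw [h]
        exacts [h2, h1]
      · refine ⟨l p, hmemL hl, ?_⟩
        simp only [hf, ho, hl, if_false, add_zero]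
        exact le_rfl
    · have h1 := Finset.card_union_le (L \ Lb) (Ob ∪ W b)
      have h2 : (L \ Lb).card + Lb.card = L.card :=
        Finset.card_sdiff_add_card_eq_card (Finset.filter_subset _ L)
      omega
    · refine le_trans (Finset.card_le_card fun u hu => ?_) (hadd.trans (ht b hb))
      rw [Finset.mem_sdiff, Finset.mem_union, Finset.mem_sdiff] at hu
      tauto
    · refine le_trans (Finset.card_le_card fun u hu => ?_) (ht b hb)
      rw [Finset.mem_sdiff, Finset.mem_union, Finset.mem_sdiff] at hu
      by_contra h
      exact hu.2 (Or.inl ⟨hu.1, h⟩)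
  have htotal : ∑ b ∈ Finset.range n, ∑ p ∈ P, f b p ≤ n * profit P s L := by
    have := Finset.sum_le_card_nsmul (Finset.range n) _ _ fun b hb =>
      hswap b (Finset.mem_range.1 hb)
    rwa [Finset.card_range, nsmul_eq_mul] at this
  rw [Finset.sum_comm] at htotal
  have hcol : ∀ p, ∑ b ∈ Finset.range n, f b p = n * sL p + (sO p - sL p) := by
    intro p
    simp only [hf, Finset.sum_add_distrib, Finset.sum_ite_eq, Finset.mem_range,
      hcl _ (hoU p), hcl _ (hlU p), if_true, Finset.sum_const, Finset.card_range, nsmul_eq_mul]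
    rw [add_assoc, max_add_min, add_zero]
  simp only [hcol, Finset.sum_add_distrib, Finset.sum_sub_distrib, ← Finset.mul_sum] at htotal
  rw [hPL] at htotal
  rw [hPO, hPL]
  linarith

end Profit

lemma card_filter_comp_eq_sum {α : Type*} {S : Finset α} {cl blk : α → ℕ} {g : ℕ → ℕ}
    {n : ℕ} (hcl : ∀ u ∈ S, cl u < n) (hblk : ∀ u, blk u = g (cl u)) (b : ℕ) :
    (S.filter fun u => blk u = b).card =
      ∑ i ∈ Finset.range n with g i = b, (S.filter fun u => cl u = i).card := by
  rw [Finset.card_eq_sum_card_fiberwise (f := cl) (t := (Finset.range n).filter fun i => g i = b)]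
  · refine Finset.sum_congr rfl fun i hi => ?_
    rw [Finset.filter_filter]
    congr 1
    refine Finset.filter_congr fun u _ => ?_
    rw [hblk]
    constructor
    · exact fun h => h.2
    · rintro rfl
      exact ⟨(Finset.mem_filter.1 hi).2, rfl⟩
  · intro u hu
    rw [Finset.mem_coe, Finset.mem_filter] at hu
    rw [Finset.mem_coe, Finset.mem_filter, Finset.mem_range, ← hblk]
    exact ⟨hcl u hu.1, hu.2⟩

/-- The clusters of a division can be merged into bounded groups in each of which `O` and the
separating points do not outnumber `L`, provided `O` is slightly smaller than `L`. -/
lemma profit_le_of_card_le {d k j t M n : ℕ} {ε : ℝ} (hε : 0 < ε) (hε1 : ε < 1)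
    {P : Finset (Pt d)} {s : ℝ → ℝ} (hs : IsServiceFunction s) (hM1 : (1 : ℝ) ≤ M)
    (ht : 49 * M / ε ≤ t) (htk : t ≤ k) {L O : Finset (Pt d)} (hL : L.card = k)
    (hO : O.card = j) (hj : (j : ℝ) ≤ (1 - ε / 2) * k)
    (hopt : ∀ L' : Finset (Pt d), L'.card ≤ k → (L' \ L).card ≤ t → (L \ L').card ≤ t →
      profit P s L' ≤ profit P s L)
    {cl : Pt d → ℕ} {W : ℕ → Finset (Pt d)} (hcl : ∀ u ∈ L ∪ O, cl u < n)
    (hcard : ∀ i < n, (((L ∪ O).filter fun u => cl u = i) ∪ W i).card ≤ M)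
    (hW : ∑ i ∈ Finset.range n, ((W i).card : ℝ) ≤ ε * k / 4)
    (hsep : ∀ u ∈ L ∪ O, ∀ v ∈ L ∪ O, cl u ≠ cl v → ∀ p, ∃ w ∈ W (cl v),
      dist p w ≤ max (dist p u) (dist p v)) :
    profit P s O ≤ profit P s L := by
  have htk' : 49 * M / ε ≤ (k : ℝ) := ht.trans (by exact_mod_cast htk)
  have hk : (0 : ℝ) < k := lt_of_lt_of_le (by positivity) htk'
  set w : ℕ → ℝ := fun i => ((L.filter fun u => cl u = i).card : ℝ) with hw
  set x : ℕ → ℝ := fun i => ((O.filter fun u => cl u = i).card : ℝ) with hx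
  set y : ℕ → ℝ := fun i => ((W i).card : ℝ) with hy
  have hwM : ∀ i < n, w i ≤ M := fun i hi => by
    refine Nat.cast_le.2 (le_trans (Finset.card_le_card fun u hu => ?_) (hcard i hi))
    simp only [Finset.mem_union, Finset.mem_filter] at hu ⊢
    tauto
  have hxM : ∀ i < n, x i ≤ M := fun i hi => by
    refine Nat.cast_le.2 (le_trans (Finset.card_le_card fun u hu => ?_) (hcard i hi))
    simp only [Finset.mem_union, Finset.mem_filter] at hu ⊢
    tauto
  have hyM : ∀ i < n, y i ≤ M := fun i hi =>
    Nat.cast_le.2 (le_trans (Finset.card_le_card Finset.subset_union_right) (hcard i hi))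
  have hclL : ∀ u ∈ L, cl u < n := fun u hu => hcl u (Finset.mem_union_left _ hu)
  have hclO : ∀ u ∈ O, cl u < n := fun u hu => hcl u (Finset.mem_union_right _ hu)
  have hsw : ∑ i ∈ Finset.range n, w i = k := by
    rw [← hL, Finset.card_eq_sum_card_fiberwise (f := cl) (t := Finset.range n)
      fun u hu => Finset.mem_coe.2 (Finset.mem_range.2 (hclL u hu))]
    push_cast; rfl
  have hsx : ∑ i ∈ Finset.range n, x i = j := by
    rw [← hO, Finset.card_eq_sum_card_fiberwise (f := cl) (t := Finset.range n)
      fun u hu => Finset.mem_coe.2 (Finset.mem_range.2 (hclO u hu))]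
    push_cast; rfl
  have hjk : (j : ℝ) ≤ k := hj.trans (by nlinarith)
  have hsy0 : 0 ≤ ∑ i ∈ Finset.range n, y i := Finset.sum_nonneg fun i _ => Nat.cast_nonneg _
  have hsy : ∑ i ∈ Finset.range n, y i ≤ ε * k / 4 := hW
  set γ : ℝ := (∑ i ∈ Finset.range n, (w i - x i - y i)) / k with hγ
  have hsv : ∑ i ∈ Finset.range n, (w i - x i - y i) =
      k - j - ∑ i ∈ Finset.range n, y i := by
    rw [Finset.sum_sub_distrib, Finset.sum_sub_distrib, hsw, hsx]
  have hγ0 : ε / 4 ≤ γ := by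
    rw [hγ, hsv, le_div_iff₀ hk]
    linarith
  have hγ1 : γ ≤ 1 := by
    rw [hγ, hsv, div_le_one hk]
    have : (0 : ℝ) ≤ j := Nat.cast_nonneg j
    linarith
  set v : ℕ → ℝ := fun i => w i - x i - y i - γ * w i with hv
  have hvD : ∀ i ∈ Finset.range n, |v i| ≤ 3 * M := by
    intro i hi
    rw [Finset.mem_range] at hi
    have h1 := hwM i hi
    have h2 := hxM i hi
    have h3 := hyM i hi
    have h4 : 0 ≤ w i := Nat.cast_nonneg _
    have h5 : 0 ≤ x i := Nat.cast_nonneg _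
    have h6 : 0 ≤ y i := Nat.cast_nonneg _
    have h7 : 0 ≤ γ * w i := mul_nonneg (by linarith) h4
    have h8 : γ * w i ≤ w i := mul_le_of_le_one_left h4 hγ1
    rw [abs_le]
    simp only [hv]
    constructor <;> linarith
  have hv0 : 0 + ∑ i ∈ Finset.range n, v i = 0 := by
    simp only [hv]
    rw [Finset.sum_sub_distrib, ← Finset.mul_sum, hsw, hγ, div_mul_cancel₀ _ hk.ne']
    ring
  have hTk : 24 * M / ε ≤ ∑ i ∈ Finset.range n, w i := by
    rw [hsw]
    refine le_trans ?_ htk'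
    gcongr
    norm_num
  obtain ⟨g, n', hg, hgb⟩ := exists_balanced_partition hvD
    (fun i hi => hwM i (Finset.mem_range.1 hi)) (by positivity : 0 < 24 * (M : ℝ) / ε)
    (by positivity) (by rw [abs_zero]; positivity) hv0 hTk
  have hLne : L.Nonempty := by
    rw [← Finset.card_pos, hL]
    exact_mod_cast hk
  refine profit_le_of_division hs hL hLne hopt (cl := fun u => g (cl u)) (n := n')
    (W := fun b => ((Finset.range n).filter fun i => g i = b).biUnion W) ?_ ?_ ?_ ?_
  · exact fun u hu => hg _ (Finset.mem_range.2 (hcl u hu))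
  · intro b hb
    obtain ⟨h1, h2, -⟩ := hgb b hb
    rw [card_filter_comp_eq_sum hclO (fun _ => rfl) b,
      card_filter_comp_eq_sum hclL (fun _ => rfl) b]
    refine (Nat.add_le_add_left Finset.card_biUnion_le _).trans ?_
    simp only [hv] at h1
    rw [Finset.sum_sub_distrib, Finset.sum_sub_distrib, Finset.sum_sub_distrib,
      ← Finset.mul_sum] at h1
    have h3 : 6 * (M : ℝ) ≤ γ * ∑ i ∈ Finset.range n with g i = b, w i := by
      calc 6 * (M : ℝ) = ε / 4 * (24 * M / ε) := by field_simp; norm_num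
        _ ≤ _ := mul_le_mul hγ0 h2 (by positivity) (by linarith)
    have h4 : ∑ i ∈ Finset.range n with g i = b, x i + ∑ i ∈ Finset.range n with g i = b, y i ≤
        ∑ i ∈ Finset.range n with g i = b, w i := by linarith
    simp only [hx, hy, hw] at h4
    exact_mod_cast h4
  · intro b hb
    obtain ⟨-, -, h⟩ := hgb b hb
    rw [card_filter_comp_eq_sum hclL (fun _ => rfl) b]
    have h1 : (M : ℝ) ≤ M / ε := by
      rw [le_div_iff₀ hε]; nlinarith
    have h2 : ∑ i ∈ Finset.range n with g i = b, w i ≤ t := by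
      refine h.trans (le_trans ?_ ht)
      have : 49 * (M : ℝ) / ε = 2 * (24 * M / ε) + M / ε := by ring
      linarith
    simp only [hw] at h2
    exact_mod_cast h2
  · intro u hu v hv huv p
    obtain ⟨z, hz, h⟩ := hsep u hu v hv (fun h => huv (congrArg g h)) p
    exact ⟨z, Finset.mem_biUnion.2 ⟨cl v, Finset.mem_filter.2
      ⟨Finset.mem_range.2 (hcl v hv), rfl⟩, hz⟩, h⟩

lemma division_card_le {e m k N S : ℕ} {ε : ℝ} (hε : 0 < ε) (hm : 32 * sepConst e / ε ≤ (m : ℝ))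
    (hS : m * S ≤ 4 * sepConst e * N) (hN : N ≤ 2 * k) : (S : ℝ) ≤ ε * k / 4 := by
  have hK : (1 : ℝ) ≤ sepConst e := by exact_mod_cast one_le_sepConst e
  have h1 : (m : ℝ) * S ≤ 4 * sepConst e * N := by exact_mod_cast hS
  have h2 : (N : ℝ) ≤ 2 * k := by exact_mod_cast hN
  have h3 : (m : ℝ) * S ≤ 8 * sepConst e * k := by
    refine h1.trans ?_
    calc 4 * sepConst e * (N : ℝ) ≤ 4 * sepConst e * (2 * k) := by gcongr
      _ = _ := by ring
  rw [div_le_iff₀ hε] at hm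
  have h4 : (S : ℝ) * (32 * sepConst e) ≤ (ε * k / 4) * (32 * sepConst e) := by
    calc (S : ℝ) * (32 * sepConst e) ≤ S * (m * ε) := by gcongr
      _ = ε * (m * S) := by ring
      _ ≤ ε * (8 * sepConst e * k) := by gcongr
      _ = _ := by ring
  exact le_of_mul_le_mul_right h4 (by positivity)

lemma profit_le_of_locally_optimal {e k t : ℕ} {ε : ℝ} (hε : 0 < ε) (hε1 : ε < 1)
    {P : Finset (Pt (e + 1))} {s : ℝ → ℝ} (hs : IsServiceFunction s)
    (ht : 49 * (5 ^ (e + 1) + sepConst e) * (33 * sepConst e) ^ (e + 1) / ε ^ (e + 2) ≤ (t : ℝ))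
    {L O : Finset (Pt (e + 1))} (hL : L.card = k) (hO : O.card = k)
    (hopt : ∀ L' : Finset (Pt (e + 1)), L'.card ≤ k → (L' \ L).card ≤ t → (L \ L').card ≤ t →
      profit P s L' ≤ profit P s L) :
    (1 - ε) * profit P s O ≤ profit P s L := by
  have hO0 : 0 ≤ profit P s O := profit_nonneg hs O
  rcases le_total k t with hkt | htk
  · have := hopt O hO.le ((Finset.card_le_card Finset.sdiff_subset).trans (hO.trans_le hkt))
      ((Finset.card_le_card Finset.sdiff_subset).trans (hL.trans_le hkt))
    nlinarith
  have hK : (1 : ℝ) ≤ sepConst e := by exact_mod_cast one_le_sepConst e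
  have hm : 32 * sepConst e / ε ≤ (⌈32 * sepConst e / ε⌉₊ : ℝ) := Nat.le_ceil _
  have hm' : (⌈32 * sepConst e / ε⌉₊ : ℝ) ≤ 33 * sepConst e / ε := by
    have h1 : 1 ≤ sepConst e / ε := by rw [le_div_iff₀ hε]; linarith
    have h2 := (Nat.ceil_lt_add_one (by positivity : 0 ≤ 32 * sepConst e / ε)).le
    have h3 : 33 * sepConst e / ε = 32 * sepConst e / ε + sepConst e / ε := by ring
    linarith
  set m := ⌈32 * sepConst e / ε⌉₊
  obtain ⟨M, hM⟩ : ∃ M, M = (5 ^ (e + 1) + sepConst e) * m ^ (e + 1) := ⟨_, rfl⟩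
  have ht' : 49 * M / ε ≤ (t : ℝ) := by
    refine le_trans ?_ ht
    rw [hM]
    push_cast
    calc 49 * ((5 ^ (e + 1) + sepConst e) * (m : ℝ) ^ (e + 1)) / ε ≤
        49 * ((5 ^ (e + 1) + sepConst e) * (33 * sepConst e / ε) ^ (e + 1)) / ε := by gcongr
      _ = _ := by rw [div_pow]; field_simp; ring
  have hm0 : (0 : ℝ) < m := lt_of_lt_of_le (by positivity) hm
  have hM1 : (1 : ℝ) ≤ M := by
    have : 1 ≤ M := by
      have : 0 < m := by exact_mod_cast hm0
      rw [hM]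
      exact Nat.one_le_iff_ne_zero.2 (by positivity)
    exact_mod_cast this
  have hk : 49 ≤ ε * k := by
    have : 49 * M / ε ≤ (k : ℝ) := ht'.trans (by exact_mod_cast htk)
    rw [div_le_iff₀ hε] at this
    linarith
  have hk0 : (0 : ℝ) < k := by
    by_contra h
    nlinarith
  have hf1 : (⌊ε * k⌋₊ : ℝ) ≤ ε * k := Nat.floor_le (by positivity)
  have hf2 := Nat.lt_floor_add_one (ε * k)
  have hfk : ⌊ε * k⌋₊ ≤ k := by
    have : (⌊ε * k⌋₊ : ℝ) ≤ k := hf1.trans (by nlinarith)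
    exact_mod_cast this
  obtain ⟨O', -, hcard_eq, hfrac⟩ := exists_subset_card_mul_profit_le (P := P) hs
    (j := k - ⌊ε * k⌋₊) (O := O) (by omega)
  rw [hO, Nat.cast_sub hfk] at hfrac
  have hm2 : 2 * sepConst e ≤ m := by
    have : (2 * sepConst e : ℝ) ≤ m := by
      refine le_trans ?_ hm
      rw [le_div_iff₀ hε]
      nlinarith
    exact_mod_cast this
  obtain ⟨cl, n, W, hcl, hcard, hW, hsep⟩ := exists_division hm2 (L ∪ O')
  have hLO : (L ∪ O').card ≤ 2 * k := by
    have := Finset.card_union_le L O'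
    omega
  have hW' := division_card_le hε hm hW hLO
  rw [← hM] at hcard
  push_cast at hW'
  have hmain := profit_le_of_card_le hε hε1 hs hM1 ht' htk hL hcard_eq
    (by rw [Nat.cast_sub hfk]; linarith) hopt hcl hcard hW' hsep
  refine le_trans ?_ hmain
  refine le_of_mul_le_mul_left ?_ hk0
  calc k * ((1 - ε) * profit P s O) = (k - ε * k) * profit P s O := by ring
    _ ≤ (k - ⌊ε * k⌋₊) * profit P s O := by gcongr
    _ ≤ _ := hfrac

/-- Correctness of local search: there is a constant `c = c(d) > 0` such that, with
`t = ⌈c/ε^{d+1}⌉`, any set `L` of `k` centers that is locally optimal under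
exchanges of size `t` satisfies `ρ(L) ≥ (1−ε)·opt_k(P)`. -/
theorem stmt_16 (d : ℕ) :
    ∃ c : ℝ, 0 < c ∧
      ∀ (P : Finset (Pt d)) (s : ℝ → ℝ), IsServiceFunction s →
        ∀ (ε : ℝ), ε ∈ Set.Ioo (0 : ℝ) 1 → ∀ (k : ℕ), 1 ≤ k →
          ∀ L : Finset (Pt d), L.card = k →
            (∀ L' : Finset (Pt d), L'.card ≤ k →
              (L' \ L).card ≤ ⌈c / ε ^ (d + 1)⌉₊ →
              (L \ L').card ≤ ⌈c / ε ^ (d + 1)⌉₊ →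
              profit P s L' ≤ profit P s L) →
            profit P s L ≥
              (1 - ε) * ⨆ C : {C : Finset (Pt d) // C.card = k}, profit P s C.1 := by
  suffices h : ∃ c : ℝ, 0 < c ∧ ∀ (P : Finset (Pt d)) (s : ℝ → ℝ), IsServiceFunction s →
      ∀ ε : ℝ, ε ∈ Set.Ioo (0 : ℝ) 1 → ∀ (k : ℕ) (L : Finset (Pt d)), L.card = k →
        (∀ L' : Finset (Pt d), L'.card ≤ k → (L' \ L).card ≤ ⌈c / ε ^ (d + 1)⌉₊ →
          (L \ L').card ≤ ⌈c / ε ^ (d + 1)⌉₊ → profit P s L' ≤ profit P s L) →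
        ∀ O : Finset (Pt d), O.card = k → (1 - ε) * profit P s O ≤ profit P s L by
    obtain ⟨c, hc, h⟩ := h
    refine ⟨c, hc, fun P s hs ε hε k _ L hL hopt => ?_⟩
    have hne : Nonempty {C : Finset (Pt d) // C.card = k} := ⟨⟨L, hL⟩⟩
    have hε' : 0 < 1 - ε := by linarith [hε.2]
    rw [ge_iff_le, mul_comm, ← le_div_iff₀ hε']
    refine ciSup_le fun C => ?_
    rw [le_div_iff₀ hε', mul_comm]
    exact h P s hs ε hε k L hL hopt C.1 C.2
  rcases d with _ | e
  · refine ⟨1, one_pos, fun P s hs ε hε k L hL _ O hO => ?_⟩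
    have hOL : O = L := by
      rcases O.eq_empty_or_nonempty with rfl | hOne
      · exact (Finset.card_eq_zero.1 (hL.trans (hO.symm.trans Finset.card_empty))).symm
      · have hLne : L.Nonempty := by
          rw [← Finset.card_pos, hL, ← hO]
          exact hOne.card_pos
        rw [Finset.Nonempty.eq_univ hOne, Finset.Nonempty.eq_univ hLne]
    rw [hOL]
    nlinarith [profit_nonneg (P := P) hs L, hε.1]
  · refine ⟨49 * (5 ^ (e + 1) + sepConst e) * (33 * sepConst e) ^ (e + 1), ?_,
      fun P s hs ε hε k L hL hopt O hO =>
        profit_le_of_locally_optimal hε.1 hε.2 hs (Nat.le_ceil _) hL hO hopt⟩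
    have : (0 : ℝ) < sepConst e := by exact_mod_cast one_le_sepConst e
    positivity
end
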